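/- Let N ≥ 2, s ∈ (0,1), μ ≥ μ_0, and let Ω ⊂ ℝ^N be a bounded domain. Suppose u ∈ W^s(Ω) satisfies u ≥ 0 a.e. on ℝ^N∖Ω and E^s_μ(u,v) ≥ 0 for every v ∈ H^s_0(Ω) with v ≥ 0. Then u ≥ 0 a.e. in ℝ^N. -/

import Mathlib

open MeasureTheory Filter Set Topology Metric

noncomputable section

/-- Euclidean space `ℝ^N`. -/
abbrev EN (N : ℕ) := EuclideanSpace ℝ (Fin N)

/-- The normalizing constant `C_{N,s}` of the fractional Laplacian. -/
def CNs (N : ℕ) (s : ℝ) : ℝ :=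
  2 ^ (2*s) * Real.pi ^ (-(N:ℝ)/2) * s * Real.Gamma ((N + 2*s)/2) / Real.Gamma (1 - s)

/-- The optimal fractional Hardy constant `μ₀`. -/
def mu0 (N : ℕ) (s : ℝ) : ℝ :=
  -(2 ^ (2*s) * Real.Gamma ((N + 2*s)/4) ^ 2 / Real.Gamma ((N - 2*s)/4) ^ 2)

/-- The function `τ ↦ c_s(τ)`. -/
def csFun (N : ℕ) (s τ : ℝ) : ℝ :=
  2 ^ (2*s) * Real.Gamma ((N + τ)/2) * Real.Gamma ((2*s - τ)/2) /
    (Real.Gamma (-τ/2) * Real.Gamma ((N - 2*s + τ)/2))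

/-- `u` has fractional Laplacian `(-Δ)^s u (x) = L` at `x`, as a principal value. -/
def HasFracLap (N : ℕ) (s : ℝ) (u : EN N → ℝ) (x : EN N) (L : ℝ) : Prop :=
  Tendsto (fun ε : ℝ =>
      CNs N s * ∫ z in {z : EN N | ε ≤ dist x z}, (u x - u z) / dist x z ^ ((N:ℝ) + 2*s))
    (𝓝[>] 0) (𝓝 L)

/-- `v` has weighted fractional Laplacian `(-Δ)^s_{Γ_μ} v (x) = L` at `x`, where the weight
is `Γ_μ(z) = ‖z‖ ^ τp` with `τp = τ₊(s,μ)`. -/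
def HasWFracLap (N : ℕ) (s τp : ℝ) (v : EN N → ℝ) (x : EN N) (L : ℝ) : Prop :=
  Tendsto (fun ε : ℝ =>
      CNs N s * ∫ z in {z : EN N | ε ≤ dist x z},
        (v x - v z) * ‖z‖ ^ τp / dist x z ^ ((N:ℝ) + 2*s))
    (𝓝[>] 0) (𝓝 L)

/-- Membership in `L¹(ℝ^N, dx/(1+|x|^{N+2s}))`. -/
def MemL1w (N : ℕ) (s : ℝ) (u : EN N → ℝ) : Prop :=
  Integrable (fun x : EN N => u x / (1 + ‖x‖ ^ ((N:ℝ) + 2*s)))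

/-- Membership in `L^∞_loc(ℝ^N \ {0})`. -/
def LocBddAway (N : ℕ) (u : EN N → ℝ) : Prop :=
  ∀ K : Set (EN N), IsCompact K → (0:EN N) ∉ K → ∃ C : ℝ, ∀ x ∈ K, |u x| ≤ C

/-- Local `θ`-Hölder continuity on compact subsets of `S`, i.e. `C^θ_loc(S)`. -/
def HolderLocOn (N : ℕ) (θ : ℝ) (f : EN N → ℝ) (S : Set (EN N)) : Prop :=
  ∀ K ⊆ S, IsCompact K → ∃ C : ℝ, ∀ x ∈ K, ∀ y ∈ K, |f x - f y| ≤ C * dist x y ^ θ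

/-- Membership in `L^∞_loc(S)`. -/
def LinfLocOn (N : ℕ) (f : EN N → ℝ) (S : Set (EN N)) : Prop :=
  AEMeasurable f ∧ ∀ K ⊆ S, IsCompact K → ∃ C : ℝ, ∀ x ∈ K, |f x| ≤ C

/-- A bounded `C²` domain: open, connected and bounded, whose boundary is the regular zero
level set of a `C²` defining function. -/
structure IsBoundedC2Domain (N : ℕ) (Ω : Set (EN N)) : Prop where
  isOpen : IsOpen Ω
  isConnected : IsConnected Ω
  isBounded : Bornology.IsBounded Ω
  c2Boundary : ∃ φ : EN N → ℝ, ContDiff ℝ 2 φ ∧ Ω = {x | φ x < 0} ∧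
    ∀ x ∈ frontier Ω, fderiv ℝ φ x ≠ 0

/-- A bounded domain: open, connected and bounded. -/
def IsBoundedDomain (N : ℕ) (Ω : Set (EN N)) : Prop :=
  IsOpen Ω ∧ IsConnected Ω ∧ Bornology.IsBounded Ω

/-- The first standard coordinate vector `e₁ ∈ ℝ^N`. -/
def e1 (N : ℕ) : EN N :=
  (EuclideanSpace.equiv (Fin N) ℝ).symm (fun i => if (i:ℕ) = 0 then 1 else 0)

/-- The surface measure `ω_{N-1}` of the unit sphere in `ℝ^N`. -/
def omegaN (N : ℕ) : ℝ := N * (volume (ball (0 : EN N) 1)).toReal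

/-- The normalization constant `c_{s,0}`. -/
def cs0 (N : ℕ) (s : ℝ) : ℝ :=
  CNs N s * omegaN N * ∫ t in Ioo (0:ℝ) 1, ∫ z in ball (0:EN N) t,
    (‖z‖ ^ (2*s - N) - 1) / ‖e1 N - z‖ ^ ((N:ℝ) + 2*s)

/-- The fundamental solution `Φ_μ`, expressed via the exponent `τ = τ₋(s,μ)`:
`Φ_μ(x) = |x|^τ` for `μ ≠ μ₀` and `Φ_{μ₀}(x) = -|x|^τ ln |x|`. -/
def Phi (N : ℕ) (s μ τ : ℝ) (x : EN N) : ℝ :=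
  if μ = mu0 N s then -(‖x‖ ^ τ * Real.log ‖x‖) else ‖x‖ ^ τ

/-- The integrand appearing in the definition of `c_{s,μ}`. -/
def cIntegrand (N : ℕ) (s μ τm τp : ℝ) (z : EN N) : ℝ :=
  if μ = mu0 N s then ‖z‖ ^ ((2*s - N)/2) * (-Real.log ‖z‖) / ‖e1 N - z‖ ^ ((N:ℝ) + 2*s)
  else (‖z‖ ^ τm - ‖z‖ ^ τp) / ‖e1 N - z‖ ^ ((N:ℝ) + 2*s)

/-- The normalization constant `c_{s,μ}`. -/
def csmu (N : ℕ) (s μ τm τp : ℝ) : ℝ :=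
  CNs N s * omegaN N * ∫ t in Ioo (0:ℝ) 1, ∫ z in ball (0:EN N) t, cIntegrand N s μ τm τp z

/-- The weight `Λ_μ`, expressed via `τp = τ₊(s,μ)`. -/
def Lam (N : ℕ) (s τp : ℝ) (x : EN N) : ℝ :=
  if 2*s - 1 < τp then 1
  else if τp < 2*s - 1 then ‖x‖ ^ (1 - 2*s + τp)
  else 1 + max (-Real.log ‖x‖) 0

/-- The quadratic form `E^s(u,v)`. -/
def Es (N : ℕ) (s : ℝ) (u v : EN N → ℝ) : ℝ :=
  (CNs N s / 2) *
    ∫ p : EN N × EN N, (u p.1 - u p.2) * (v p.1 - v p.2) / dist p.1 p.2 ^ ((N:ℝ) + 2*s)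

/-- The quadratic form `E^s_μ(u,v)`. -/
def Esmu (N : ℕ) (s μ : ℝ) (u v : EN N → ℝ) : ℝ :=
  Es N s u v + μ * ∫ x : EN N, u x * v x / ‖x‖ ^ (2*s)

/-- `E^s_{A,B}(u,u) < ∞`. -/
def FiniteEnergyOn (N : ℕ) (s : ℝ) (u : EN N → ℝ) (A B : Set (EN N)) : Prop :=
  IntegrableOn (fun p : EN N × EN N => (u p.1 - u p.2)^2 / dist p.1 p.2 ^ ((N:ℝ) + 2*s)) (A ×ˢ B)

/-- Membership in `H^s(ℝ^N)`: locally `L²` with finite Gagliardo seminorm. -/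
def MemHs (N : ℕ) (s : ℝ) (u : EN N → ℝ) : Prop :=
  (∀ K : Set (EN N), IsCompact K → IntegrableOn (fun x => (u x)^2) K) ∧
  FiniteEnergyOn N s u univ univ

/-- Membership in `H^s_0(Ω)`. -/
def MemHs0 (N : ℕ) (s : ℝ) (Ω : Set (EN N)) (u : EN N → ℝ) : Prop :=
  MemHs N s u ∧ ∀ᵐ x : EN N, x ∉ Ω → u x = 0

/-- Membership in `W^s(Ω)`. -/
def MemWs (N : ℕ) (s : ℝ) (Ω : Set (EN N)) (u : EN N → ℝ) : Prop :=
  MemL1w N s u ∧ IntegrableOn (fun x => (u x)^2) Ω ∧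
  ∃ Ω' : Set (EN N), IsOpen Ω' ∧ IsConnected Ω' ∧ closure Ω ⊆ Ω' ∧ FiniteEnergyOn N s u Ω Ω'

/-- Membership in `W^s_*(Ω)`. -/
def MemWsStar (N : ℕ) (s : ℝ) (Ω : Set (EN N)) (u : EN N → ℝ) : Prop :=
  MemL1w N s u ∧ ∀ ε : ℝ, 0 < ε → MemWs N s (Ω \ closedBall 0 ε) u

/-- The distributional identity `L^s_μ u = f` in `Ω \ {0}`, tested against `C^∞_c(Ω\{0})`. -/
def DistrEq (N : ℕ) (s μ : ℝ) (Ω : Set (EN N)) (f u : EN N → ℝ) : Prop :=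
  ∀ φ : EN N → ℝ, ContDiff ℝ (⊤ : ℕ∞) φ → HasCompactSupport φ → tsupport φ ⊆ Ω \ {0} →
    ∀ g : EN N → ℝ, (∀ x, HasFracLap N s φ x (g x)) →
      (∫ x, u x * g x) + μ * ∫ x, u x * φ x / ‖x‖ ^ (2*s) = ∫ x in Ω, f x * φ x

/-- A distributional solution of `L^s_μ u = f` in `Ω \ {0}` with `u = 0` in `ℝ^N \ Ω`. -/
def IsDistrSol (N : ℕ) (s μ : ℝ) (Ω : Set (EN N)) (f u : EN N → ℝ) : Prop :=
  LocBddAway N u ∧ MemL1w N s u ∧ (∀ x ∉ Ω, u x = 0) ∧ DistrEq N s μ Ω f u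


/-! ### One-dimensional integrals -/

lemma lint_gamma {a r : ℝ} (ha : 0 < a) (hr : 0 < r) :
    ∫⁻ t in Ioi (0:ℝ), ENNReal.ofReal (t ^ (a-1) * Real.exp (-(r*t)))
      = ENNReal.ofReal ((1/r)^a * Real.Gamma a) := by
  have h := Real.integral_rpow_mul_exp_neg_mul_Ioi ha hr
  have hpos : 0 < (1/r)^a * Real.Gamma a := by
    have := Real.Gamma_pos_of_pos ha
    positivity
  rw [← h, ofReal_integral_eq_lintegral_ofReal]
  · exact Integrable.of_integral_ne_zero (by rw [h]; exact hpos.ne')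
  · filter_upwards [ae_restrict_mem measurableSet_Ioi] with t ht
    have : (0:ℝ) < t := ht
    simp only [Pi.zero_apply]; positivity

lemma lint_scale (F : ℝ → ENNReal) {c : ℝ} (hc : 0 < c) :
    ∫⁻ t in Ioi (0:ℝ), F t = ENNReal.ofReal c * ∫⁻ r in Ioi (0:ℝ), F (c * r) := by
  have h := lintegral_image_eq_lintegral_abs_deriv_mul (s := Ioi (0:ℝ)) (f := fun r => c * r)
    (f' := fun _ => c) measurableSet_Ioi
    (fun x _ => by simpa using ((hasDerivAt_id x).const_mul c).hasDerivWithinAt)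
    (fun x _ y _ h => by simpa [hc.ne'] using h) F
  have him : (fun r => c * r) '' Ioi (0:ℝ) = Ioi 0 := by
    rw [Set.image_mul_left_Ioi hc]; simp
  rw [him] at h
  rw [h, lintegral_const_mul' _ _ ENNReal.ofReal_ne_top, abs_of_pos hc]

/-- Truncated power. -/
def cut (β x : ℝ) : ℝ := if 0 < x then x ^ (β-1) else 0

lemma cut_nonneg (β x : ℝ) : 0 ≤ cut β x := by
  unfold cut; split_ifs with h
  · positivity
  · exact le_rfl

@[fun_prop]
lemma measurable_cut (β : ℝ) : Measurable (cut β) := by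
  unfold cut
  exact Measurable.ite measurableSet_Ioi (by fun_prop) (by fun_prop)

lemma lint_shift (β : ℝ) (F : ℝ → ENNReal) {τ : ℝ} (hτ : 0 < τ) :
    ∫⁻ t in Ioi (0:ℝ), ENNReal.ofReal (cut β (t-τ)) * F t =
      ∫⁻ t in Ioi (0:ℝ), ENNReal.ofReal (t ^ (β-1)) * F (t + τ) := by
  rw [← lintegral_indicator measurableSet_Ioi, ← lintegral_indicator measurableSet_Ioi,
    ← lintegral_add_right_eq_self _ τ]
  congr 1; ext t
  by_cases ht : 0 < t
  · have : t + τ ∈ Ioi (0:ℝ) := by simp only [mem_Ioi]; linarith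
    rw [indicator_of_mem this, indicator_of_mem (show t ∈ Ioi (0:ℝ) from ht)]
    simp [cut, ht]
  · rw [indicator_of_notMem (show t ∉ Ioi (0:ℝ) from ht)]
    simp only [indicator]
    split_ifs <;> simp [cut, ht]

/-- The constants `K₊`, `K₋`. -/
def Ksig (β s σ : ℝ) : ENNReal :=
  ∫⁻ r in Ioi (0:ℝ), ENNReal.ofReal (r ^ (-1-s)) * ENNReal.ofReal (σ * (1 - cut β (1-r)))

lemma inner_scale (β s σ : ℝ) {t : ℝ} (ht : 0 < t) :
    ∫⁻ τ in Ioi (0:ℝ), ENNReal.ofReal (τ ^ (-1-s)) *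
        ENNReal.ofReal (σ * (t ^ (β-1) - cut β (t-τ)))
      = ENNReal.ofReal (t ^ (β-1-s)) * Ksig β s σ := by
  rw [lint_scale _ ht, Ksig, ← lintegral_const_mul' _ _ ENNReal.ofReal_ne_top,
    ← lintegral_const_mul' _ _ ENNReal.ofReal_ne_top]
  refine setLIntegral_congr_fun measurableSet_Ioi fun r hr => ?_
  have hr : 0 < r := hr
  have h1 : cut β (t - t * r) = t ^ (β-1) * cut β (1-r) := by
    have : t - t * r = t * (1-r) := by ring
    rw [this]; unfold cut
    by_cases h : 0 < 1 - r
    · rw [if_pos h, if_pos (by positivity), Real.mul_rpow ht.le h.le]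
    · rw [if_neg h, if_neg (by intro h'; exact h (pos_of_mul_pos_right h' ht.le)), mul_zero]
  rw [h1, ← ENNReal.ofReal_mul (by positivity), ← ENNReal.ofReal_mul (by positivity),
    ← ENNReal.ofReal_mul (by positivity), ← ENNReal.ofReal_mul (by positivity)]
  congr 1
  rw [Real.mul_rpow ht.le hr.le]
  have h2 : t ^ (β-1-s) = t * t ^ (-1-s) * t ^ (β-1) := by
    nth_rewrite 2 [← Real.rpow_one t]
    rw [← Real.rpow_add ht, ← Real.rpow_add ht]; congr 1; ring
  rw [h2]; ring

lemma outer_swap (β s σ : ℝ) (f : ℝ → ENNReal) (hf : Measurable f) :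
    ∫⁻ τ in Ioi (0:ℝ), ENNReal.ofReal (τ ^ (-1-s)) *
        ∫⁻ t in Ioi (0:ℝ), ENNReal.ofReal (σ * (t ^ (β-1) - cut β (t-τ))) * f t
      = Ksig β s σ * ∫⁻ t in Ioi (0:ℝ), ENNReal.ofReal (t ^ (β-1-s)) * f t := by
  have hm : Measurable (fun p : ℝ × ℝ => ENNReal.ofReal (p.1 ^ (-1-s)) *
      (ENNReal.ofReal (σ * (p.2 ^ (β-1) - cut β (p.2-p.1))) * f p.2)) := by fun_prop
  calc _ = ∫⁻ τ in Ioi (0:ℝ), ∫⁻ t in Ioi (0:ℝ), ENNReal.ofReal (τ ^ (-1-s)) *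
        (ENNReal.ofReal (σ * (t ^ (β-1) - cut β (t-τ))) * f t) := by
        congr 1; ext τ
        rw [lintegral_const_mul' _ _ ENNReal.ofReal_ne_top]
    _ = ∫⁻ t in Ioi (0:ℝ), ∫⁻ τ in Ioi (0:ℝ), ENNReal.ofReal (τ ^ (-1-s)) *
        (ENNReal.ofReal (σ * (t ^ (β-1) - cut β (t-τ))) * f t) :=
        lintegral_lintegral_swap hm.aemeasurable
    _ = ∫⁻ t in Ioi (0:ℝ), Ksig β s σ * (ENNReal.ofReal (t ^ (β-1-s)) * f t) := by
        refine setLIntegral_congr_fun measurableSet_Ioi fun t ht => ?_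
        simp only [← mul_assoc]
        rw [lintegral_mul_const _ (by fun_prop), inner_scale β s σ ht]
        ring
    _ = _ := lintegral_const_mul _ (by fun_prop)

lemma bal (β : ℝ) (f : ℝ → ENNReal) (hf : Measurable f) (τ : ℝ) :
    (∫⁻ t in Ioi (0:ℝ), ENNReal.ofReal (t ^ (β-1)) * f t) +
      (∫⁻ t in Ioi (0:ℝ), ENNReal.ofReal ((-1) * (t ^ (β-1) - cut β (t-τ))) * f t) =
    (∫⁻ t in Ioi (0:ℝ), ENNReal.ofReal (cut β (t-τ)) * f t) +
      (∫⁻ t in Ioi (0:ℝ), ENNReal.ofReal (1 * (t ^ (β-1) - cut β (t-τ))) * f t) := by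
  rw [← lintegral_add_left (by fun_prop), ← lintegral_add_left (by fun_prop)]
  refine setLIntegral_congr_fun measurableSet_Ioi fun t ht => ?_
  have ht : 0 < t := ht
  rw [← add_mul, ← add_mul]
  congr 1
  have h1 : 0 ≤ t ^ (β-1) := by positivity
  have h2 := cut_nonneg β (t-τ)
  generalize t ^ (β-1) = a at *
  generalize cut β (t-τ) = b at *
  rcases le_total a b with h | h
  · rw [ENNReal.ofReal_of_nonpos (p := 1 * (a-b)) (by linarith),
      ← ENNReal.ofReal_add h1 (by linarith), add_zero]
    congr 1; ring
  · rw [ENNReal.ofReal_of_nonpos (p := -1 * (a-b)) (by linarith),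
      ← ENNReal.ofReal_add h2 (by linarith), add_zero]
    congr 1; ring

lemma Kneg_ne_top {β s : ℝ} (hβ : 0 < β) (hs0 : 0 < s) (hs1 : s < 1) : Ksig β s (-1) ≠ ⊤ := by
  have hb := ProbabilityTheory.lintegral_betaPDF_eq_one (α := 1-s) (β := β) (by linarith) hβ
  rw [ProbabilityTheory.lintegral_betaPDF] at hb
  have hBpos := ProbabilityTheory.beta_pos (α := 1-s) (β := β) (by linarith) hβ
  set B := ProbabilityTheory.beta (1-s) β with hB
  have hle : Ksig β s (-1) ≤ ENNReal.ofReal B * ∫⁻ x in Ioo (0:ℝ) 1,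
      ENNReal.ofReal (1 / B * x ^ (1 - s - 1) * (1 - x) ^ (β - 1)) := by
    rw [Ksig, ← lintegral_const_mul' _ _ ENNReal.ofReal_ne_top,
      ← lintegral_indicator measurableSet_Ioi, ← lintegral_indicator measurableSet_Ioo]
    refine lintegral_mono fun r => ?_
    by_cases h0 : 0 < r
    · rw [indicator_of_mem (show r ∈ Ioi (0:ℝ) from h0)]
      by_cases h1 : r < 1
      · rw [indicator_of_mem (show r ∈ Ioo (0:ℝ) 1 from ⟨h0, h1⟩),
          ← ENNReal.ofReal_mul (by positivity), ← ENNReal.ofReal_mul hBpos.le]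
        apply ENNReal.ofReal_le_ofReal
        have h1' : 0 < 1 - r := by linarith
        rw [cut, if_pos h1']
        have e1 : B * (1 / B * r ^ (1 - s - 1) * (1 - r) ^ (β - 1)) =
            r ^ (-1-s) * (r * (1-r)^(β-1)) := by
          have : r ^ (1-s-1) = r ^ (-1-s) * r := by
            nth_rewrite 3 [← Real.rpow_one r]
            rw [← Real.rpow_add h0]; congr 1; ring
          rw [this]; field_simp
        rw [e1]
        apply mul_le_mul_of_nonneg_left _ (by positivity)
        have e2 : (1-r)^(β-1) * (1-r) ≤ 1 := by
          nth_rewrite 2 [← Real.rpow_one (1-r)]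
          rw [← Real.rpow_add h1']
          exact Real.rpow_le_one h1'.le (by linarith) (by linarith)
        nlinarith
      · have : ¬ (0 < 1 - r) := by linarith
        rw [cut, if_neg this, ENNReal.ofReal_of_nonpos (p := -1 * (1-0)) (by norm_num), mul_zero]
        exact zero_le
    · rw [indicator_of_notMem (show r ∉ Ioi (0:ℝ) from h0)]; simp
  refine ne_top_of_le_ne_top ?_ hle
  rw [hb]; simp

lemma lint_one_sub_exp {s : ℝ} (hs0 : 0 < s) (hs1 : s < 1) :
    ∫⁻ τ in Ioi (0:ℝ), ENNReal.ofReal (τ ^ (-1-s)) * ENNReal.ofReal (1 - Real.exp (-τ))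
      = ENNReal.ofReal (Real.Gamma (1-s) / s) := by
  set G : ℝ × ℝ → ENNReal :=
    {q : ℝ × ℝ | q.2 ≤ q.1}.indicator (fun q => ENNReal.ofReal (Real.exp (-q.2))) with hG
  have hGm : Measurable G :=
    Measurable.indicator (by fun_prop) (measurableSet_le measurable_snd measurable_fst)
  have hm : Measurable (fun p : ℝ × ℝ => ENNReal.ofReal (p.1 ^ (-1-s)) * G p) :=
    Measurable.mul (by fun_prop) hGm
  have h1 : ∀ τ : ℝ, 0 < τ → ENNReal.ofReal (1 - Real.exp (-τ)) =
      ∫⁻ σ in Ioi (0:ℝ), G (τ, σ) := by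
    intro τ hτ
    have : ∫ x in (0:ℝ)..τ, Real.exp (-x) = 1 - Real.exp (-τ) := by
      rw [intervalIntegral.integral_comp_neg]; simp
    rw [← this, intervalIntegral.integral_of_le hτ.le, ofReal_integral_eq_lintegral_ofReal,
      ← lintegral_indicator measurableSet_Ioi, ← lintegral_indicator measurableSet_Ioc]
    · congr 1; ext σ
      simp only [indicator, hG, mem_Ioc, mem_Ioi, mem_setOf_eq]
      by_cases a : 0 < σ <;> by_cases b : σ ≤ τ <;> simp [a, b]
    · exact (Continuous.integrableOn_Icc (by fun_prop)).mono_set Ioc_subset_Icc_self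
    · exact ae_of_all _ fun x => (Real.exp_pos _).le
  have h2 : ∀ σ : ℝ, 0 < σ → ∫⁻ τ in Ioi (0:ℝ), ENNReal.ofReal (τ ^ (-1-s)) * G (τ, σ) =
      ENNReal.ofReal (1/s) * ENNReal.ofReal (σ ^ ((1-s) - 1) * Real.exp (-(1*σ))) := by
    intro σ hσ
    have e1 : ∫⁻ τ in Ioi (0:ℝ), ENNReal.ofReal (τ ^ (-1-s)) * G (τ, σ) =
        ∫⁻ τ in Ici σ, ENNReal.ofReal (τ ^ (-1-s)) * ENNReal.ofReal (Real.exp (-σ)) := by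
      rw [← lintegral_indicator measurableSet_Ioi, ← lintegral_indicator measurableSet_Ici]
      congr 1; ext τ
      simp only [indicator, hG, mem_Ici, mem_Ioi, mem_setOf_eq]
      by_cases b : σ ≤ τ
      · have a : 0 < τ := by linarith
        simp [a, b]
      · simp [b]
    rw [e1, setLIntegral_congr Ioi_ae_eq_Ici.symm, lintegral_mul_const _ (by fun_prop),
      ← ofReal_integral_eq_lintegral_ofReal (integrableOn_Ioi_rpow_of_lt (by linarith) hσ),
      integral_Ioi_rpow_of_lt (by linarith) hσ, ← ENNReal.ofReal_mul, ← ENNReal.ofReal_mul]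
    · congr 1
      have : (-1 - s + 1) = -s := by ring
      rw [this, show (1-s)-1 = -s by ring, one_mul]
      field_simp
    · positivity
    · have : (-1 - s + 1) = -s := by ring
      rw [this, neg_div_neg_eq]; positivity
    · filter_upwards [ae_restrict_mem measurableSet_Ioi] with t ht
      have : (0:ℝ) < t := hσ.trans ht
      simp only [Pi.zero_apply]; positivity
  calc _ = ∫⁻ τ in Ioi (0:ℝ), ∫⁻ σ in Ioi (0:ℝ), ENNReal.ofReal (τ ^ (-1-s)) * G (τ, σ) := by
        refine setLIntegral_congr_fun measurableSet_Ioi fun τ hτ => ?_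
        rw [h1 τ hτ, lintegral_const_mul' _ _ ENNReal.ofReal_ne_top]
    _ = ∫⁻ σ in Ioi (0:ℝ), ∫⁻ τ in Ioi (0:ℝ), ENNReal.ofReal (τ ^ (-1-s)) * G (τ, σ) :=
        lintegral_lintegral_swap hm.aemeasurable
    _ = ∫⁻ σ in Ioi (0:ℝ), ENNReal.ofReal (1/s) *
          ENNReal.ofReal (σ ^ ((1-s) - 1) * Real.exp (-(1*σ))) :=
        setLIntegral_congr_fun measurableSet_Ioi fun σ hσ => h2 σ hσ
    _ = _ := by
        rw [lintegral_const_mul' _ _ ENNReal.ofReal_ne_top, lint_gamma (by linarith) one_pos,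
          ← ENNReal.ofReal_mul (by positivity)]
        congr 1
        simp; ring

/-- The value of the difference of the two constants. -/
def Kc (β s : ℝ) : ℝ := Real.Gamma β * (Real.Gamma (1-s) / s) / Real.Gamma (β-s)

lemma Kpos_eq {β s : ℝ} (hs0 : 0 < s) (hs1 : s < 1) (hβ : s < β) :
    Ksig β s 1 = Ksig β s (-1) + ENNReal.ofReal (Kc β s) := by
  set f : ℝ → ENNReal := fun t => ENNReal.ofReal (Real.exp (-(1*t))) with hf
  have hfm : Measurable f := by fun_prop
  have hβ0 : 0 < β := hs0.trans hβ
  have hG : 0 < Real.Gamma (β-s) := Real.Gamma_pos_of_pos (by linarith)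
  have hG1 : 0 < Real.Gamma (1-s) := Real.Gamma_pos_of_pos (by linarith)
  have hGb : 0 < Real.Gamma β := Real.Gamma_pos_of_pos hβ0
  have hpow : ∀ {a : ℝ}, 0 < a → ∫⁻ t in Ioi (0:ℝ), ENNReal.ofReal (t ^ (a-1)) * f t =
      ENNReal.ofReal (Real.Gamma a) := by
    intro a ha
    have := lint_gamma ha one_pos
    rw [div_one, Real.one_rpow, one_mul] at this
    rw [← this]
    refine setLIntegral_congr_fun measurableSet_Ioi fun t ht => ?_
    have ht : (0:ℝ) < t := ht
    rw [← ENNReal.ofReal_mul (by positivity)]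
  have key : ∀ τ : ℝ, 0 < τ →
      (∫⁻ t in Ioi (0:ℝ), ENNReal.ofReal ((-1) * (t ^ (β-1) - cut β (t-τ))) * f t) +
        ENNReal.ofReal (Real.Gamma β) * ENNReal.ofReal (1 - Real.exp (-τ)) =
      (∫⁻ t in Ioi (0:ℝ), ENNReal.ofReal (1 * (t ^ (β-1) - cut β (t-τ))) * f t) := by
    intro τ hτ
    have hb := bal β f hfm τ
    have h2 : ∫⁻ t in Ioi (0:ℝ), ENNReal.ofReal (cut β (t-τ)) * f t =
        ENNReal.ofReal (Real.Gamma β) * ENNReal.ofReal (Real.exp (-τ)) := by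
      rw [lint_shift β f hτ, ← hpow hβ0, ← lintegral_mul_const _ (by fun_prop)]
      congr 1; ext t
      rw [hf, mul_assoc, ← ENNReal.ofReal_mul (Real.exp_pos _).le, ← Real.exp_add]
      congr 3; ring
    have h3 : ENNReal.ofReal (Real.Gamma β) = ENNReal.ofReal (Real.Gamma β) *
        ENNReal.ofReal (Real.exp (-τ)) +
        ENNReal.ofReal (Real.Gamma β) * ENNReal.ofReal (1 - Real.exp (-τ)) := by
      have : Real.exp (-τ) ≤ 1 := Real.exp_le_one_iff.2 (by linarith)
      rw [← mul_add, ← ENNReal.ofReal_add (Real.exp_pos _).le (by linarith)]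
      simp
    rw [hpow hβ0, h2] at hb
    nth_rewrite 1 [h3] at hb
    rw [add_assoc] at hb
    rw [add_comm]
    exact (ENNReal.add_right_inj (ENNReal.mul_ne_top ENNReal.ofReal_ne_top
      ENNReal.ofReal_ne_top)).1 hb
  have hP := outer_swap β s 1 f hfm
  have hN := outer_swap β s (-1) f hfm
  have e : β - 1 - s = (β - s) - 1 := by ring
  rw [e, hpow (by linarith)] at hP hN
  have hsum : ∫⁻ τ in Ioi (0:ℝ), ENNReal.ofReal (τ ^ (-1-s)) *
        (∫⁻ t in Ioi (0:ℝ), ENNReal.ofReal (1 * (t ^ (β-1) - cut β (t-τ))) * f t) =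
      (∫⁻ τ in Ioi (0:ℝ), ENNReal.ofReal (τ ^ (-1-s)) *
        ∫⁻ t in Ioi (0:ℝ), ENNReal.ofReal ((-1) * (t ^ (β-1) - cut β (t-τ))) * f t) +
      ENNReal.ofReal (Real.Gamma β) * ENNReal.ofReal (Real.Gamma (1-s) / s) := by
    rw [← lint_one_sub_exp hs0 hs1, ← lintegral_const_mul' _ _ ENNReal.ofReal_ne_top,
      ← lintegral_add_right _ (by fun_prop)]
    refine setLIntegral_congr_fun measurableSet_Ioi fun τ hτ => ?_
    rw [← key τ hτ]; ring
  rw [hP, hN] at hsum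
  have h4 : ENNReal.ofReal (Real.Gamma β) * ENNReal.ofReal (Real.Gamma (1-s) / s) =
      ENNReal.ofReal (Kc β s) * ENNReal.ofReal (Real.Gamma (β-s)) := by
    rw [← ENNReal.ofReal_mul hGb.le, ← ENNReal.ofReal_mul (by unfold Kc; positivity)]
    congr 1; unfold Kc; field_simp
  rw [h4, ← add_mul] at hsum
  exact (ENNReal.mul_left_inj (by simpa using hG) ENNReal.ofReal_ne_top).1 hsum

lemma oneD {β s : ℝ} (hs0 : 0 < s) (hs1 : s < 1) (hβ : s < β)
    (D R f : ℝ → ENNReal) (hD : Measurable D) (hR : Measurable R) (hf : Measurable f)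
    (hb : ∫⁻ t in Ioi (0:ℝ), ENNReal.ofReal (t ^ (β-1)) * f t ≠ ⊤)
    (hI : ∫⁻ t in Ioi (0:ℝ), ENNReal.ofReal (t ^ (β-1-s)) * f t ≠ ⊤)
    (h : ∀ τ : ℝ, 0 < τ →
      D τ + 2 * ∫⁻ t in Ioi (0:ℝ), ENNReal.ofReal (cut β (t-τ)) * f t =
      R τ + 2 * ∫⁻ t in Ioi (0:ℝ), ENNReal.ofReal (t ^ (β-1)) * f t) :
    ∫⁻ τ in Ioi (0:ℝ), ENNReal.ofReal (τ ^ (-1-s)) * D τ =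
      (∫⁻ τ in Ioi (0:ℝ), ENNReal.ofReal (τ ^ (-1-s)) * R τ) +
      2 * ENNReal.ofReal (Kc β s) *
        ∫⁻ t in Ioi (0:ℝ), ENNReal.ofReal (t ^ (β-1-s)) * f t := by
  have hβ0 : 0 < β := hs0.trans hβ
  set I := ∫⁻ t in Ioi (0:ℝ), ENNReal.ofReal (t ^ (β-1-s)) * f t with hIdef
  set b := ∫⁻ t in Ioi (0:ℝ), ENNReal.ofReal (t ^ (β-1)) * f t with hbdef
  set P : ℝ → ENNReal := fun τ =>
    ∫⁻ t in Ioi (0:ℝ), ENNReal.ofReal (1 * (t ^ (β-1) - cut β (t-τ))) * f t with hP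
  set Q : ℝ → ENNReal := fun τ =>
    ∫⁻ t in Ioi (0:ℝ), ENNReal.ofReal ((-1) * (t ^ (β-1) - cut β (t-τ))) * f t with hQ
  have hPm : Measurable P := Measurable.lintegral_prod_right'
    (f := fun p : ℝ × ℝ => ENNReal.ofReal (1 * (p.2 ^ (β-1) - cut β (p.2-p.1))) * f p.2)
    (by fun_prop)
  have hQm : Measurable Q := Measurable.lintegral_prod_right'
    (f := fun p : ℝ × ℝ => ENNReal.ofReal ((-1) * (p.2 ^ (β-1) - cut β (p.2-p.1))) * f p.2)
    (by fun_prop)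
  have key : ∀ τ : ℝ, 0 < τ → D τ + 2 * Q τ = R τ + 2 * P τ := by
    intro τ hτ
    have h1 := h τ hτ
    have h2 : b + Q τ = _ + P τ := bal β f hf τ
    set a := ∫⁻ t in Ioi (0:ℝ), ENNReal.ofReal (cut β (t-τ)) * f t
    have h3 : 2 * b + (D τ + 2 * Q τ) = 2 * b + (R τ + 2 * P τ) := by
      calc _ = D τ + 2 * (b + Q τ) := by ring
        _ = (D τ + 2 * a) + 2 * P τ := by rw [h2]; ring
        _ = _ := by rw [h1]; ring
    exact (ENNReal.add_right_inj (ENNReal.mul_ne_top (by simp) hb)).1 h3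
  have e1 : ∫⁻ τ in Ioi (0:ℝ), ENNReal.ofReal (τ ^ (-1-s)) * P τ = Ksig β s 1 * I :=
    outer_swap β s 1 f hf
  have e2 : ∫⁻ τ in Ioi (0:ℝ), ENNReal.ofReal (τ ^ (-1-s)) * Q τ = Ksig β s (-1) * I :=
    outer_swap β s (-1) f hf
  have e3 : (∫⁻ τ in Ioi (0:ℝ), ENNReal.ofReal (τ ^ (-1-s)) * D τ) +
      2 * ∫⁻ τ in Ioi (0:ℝ), ENNReal.ofReal (τ ^ (-1-s)) * Q τ =
      (∫⁻ τ in Ioi (0:ℝ), ENNReal.ofReal (τ ^ (-1-s)) * R τ) +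
      2 * ∫⁻ τ in Ioi (0:ℝ), ENNReal.ofReal (τ ^ (-1-s)) * P τ := by
    rw [← lintegral_const_mul _ (by fun_prop), ← lintegral_const_mul _ (by fun_prop),
      ← lintegral_add_left (by fun_prop), ← lintegral_add_left (by fun_prop)]
    refine setLIntegral_congr_fun measurableSet_Ioi fun τ hτ => ?_
    calc _ = ENNReal.ofReal (τ ^ (-1-s)) * (D τ + 2 * Q τ) := by ring
      _ = _ := by rw [key τ hτ]; ring
  rw [e1, e2, Kpos_eq hs0 hs1 hβ] at e3
  have hfin : 2 * (Ksig β s (-1) * I) ≠ ⊤ :=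
    ENNReal.mul_ne_top (by simp) (ENNReal.mul_ne_top (Kneg_ne_top hβ0 hs0 hs1) hI)
  refine (ENNReal.add_left_inj hfin).1 (e3.trans ?_)
  ring

/-! ### Gaussians -/

/-- The heat kernel. -/
def gk (N : ℕ) (t : ℝ) (x : EN N) : ℝ :=
  (4 * Real.pi * t) ^ (-(N:ℝ)/2) * Real.exp (-‖x‖^2 / (4*t))

@[fun_prop]
lemma measurable_gk {α : Type*} [MeasurableSpace α] (N : ℕ) {f : α → ℝ} {g : α → EN N}
    (hf : Measurable f) (hg : Measurable g) : Measurable (fun a => gk N (f a) (g a)) := by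
  unfold gk; fun_prop

lemma gk_pos {N : ℕ} {t : ℝ} (ht : 0 < t) (x : EN N) : 0 < gk N t x := by
  unfold gk; have := Real.pi_pos; positivity

lemma lint_exp_sq (N : ℕ) {b : ℝ} (hb : 0 < b) :
    ∫⁻ y : EN N, ENNReal.ofReal (Real.exp (-b * ‖y‖^2)) =
      ENNReal.ofReal ((Real.pi / b) ^ ((N:ℝ)/2)) := by
  have h := GaussianFourier.integral_rexp_neg_mul_sq_norm (V := EN N) hb
  rw [finrank_euclideanSpace_fin] at h
  have hpos : 0 < (Real.pi / b) ^ ((N:ℝ)/2) := by have := Real.pi_pos; positivity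
  rw [← h, ofReal_integral_eq_lintegral_ofReal]
  · exact Integrable.of_integral_ne_zero (by rw [h]; exact hpos.ne')
  · exact ae_of_all _ fun x => (Real.exp_pos _).le

lemma lint_gk (N : ℕ) {t : ℝ} (ht : 0 < t) : ∫⁻ y : EN N, ENNReal.ofReal (gk N t y) = 1 := by
  have hpi := Real.pi_pos
  have : ∀ y : EN N, ENNReal.ofReal (gk N t y) = ENNReal.ofReal ((4 * Real.pi * t) ^ (-(N:ℝ)/2)) *
      ENNReal.ofReal (Real.exp (-(1/(4*t)) * ‖y‖^2)) := by
    intro y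
    rw [← ENNReal.ofReal_mul (by positivity), gk]
    congr 3; field_simp
  simp only [this]
  rw [lintegral_const_mul' _ _ ENNReal.ofReal_ne_top, lint_exp_sq N (by positivity),
    ← ENNReal.ofReal_mul (by positivity), ← ENNReal.ofReal_one]
  congr 1
  rw [show Real.pi / (1/(4*t)) = 4 * Real.pi * t by field_simp, ← Real.rpow_add (by positivity)]
  rw [show -(N:ℝ)/2 + N/2 = 0 by ring, Real.rpow_zero]

lemma lint_conv (N : ℕ) {τ t : ℝ} (hτ : 0 < τ) (ht : 0 < t) (x : EN N) :
    ∫⁻ y : EN N, ENNReal.ofReal (gk N τ (x-y)) * ENNReal.ofReal (gk N t y) =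
      ENNReal.ofReal (gk N (t+τ) x) := by
  have hpi := Real.pi_pos
  set b := (τ+t)/(4*τ*t) with hb
  have hbpos : 0 < b := by positivity
  set m := t/(τ+t) with hm
  set C := (4 * Real.pi * τ) ^ (-(N:ℝ)/2) * (4 * Real.pi * t) ^ (-(N:ℝ)/2) *
    Real.exp (-‖x‖^2/(4*(t+τ))) with hC
  have : ∀ y : EN N, ENNReal.ofReal (gk N τ (x-y)) * ENNReal.ofReal (gk N t y) =
      ENNReal.ofReal C * ENNReal.ofReal (Real.exp (-b * ‖y - m • x‖^2)) := by
    intro y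
    rw [← ENNReal.ofReal_mul (gk_pos hτ _).le, ← ENNReal.ofReal_mul (by positivity)]
    congr 1
    have e : Real.exp (-‖x-y‖^2/(4*τ)) * Real.exp (-‖y‖^2/(4*t)) =
        Real.exp (-‖x‖^2/(4*(t+τ))) * Real.exp (-b * ‖y - m • x‖^2) := by
      rw [← Real.exp_add, ← Real.exp_add]
      congr 1
      have h1 : ‖x-y‖^2 = ‖x‖^2 - 2 * inner ℝ x y + ‖y‖^2 := norm_sub_sq_real x y
      have h2 : ‖y - m • x‖^2 = ‖y‖^2 - 2 * (m * inner ℝ x y) + m^2 * ‖x‖^2 := by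
        rw [norm_sub_sq_real, inner_smul_right, norm_smul, real_inner_comm, mul_pow,
          Real.norm_eq_abs, sq_abs]
      rw [h1, h2, hb, hm]
      have : τ + t ≠ 0 := by positivity
      have : t + τ ≠ 0 := by positivity
      field_simp
      ring
    unfold gk
    calc _ = (4 * Real.pi * τ) ^ (-(N:ℝ)/2) * (4 * Real.pi * t) ^ (-(N:ℝ)/2) *
        (Real.exp (-‖x-y‖^2/(4*τ)) * Real.exp (-‖y‖^2/(4*t))) := by ring
      _ = _ := by rw [e, hC]; ring
  simp only [this]
  rw [lintegral_const_mul' _ _ ENNReal.ofReal_ne_top,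
    lintegral_sub_right_eq_self (fun z : EN N => ENNReal.ofReal (Real.exp (-b * ‖z‖^2))),
    lint_exp_sq N hbpos, ← ENNReal.ofReal_mul (by positivity)]
  congr 1
  have hN : (N:ℝ)/2 = -(-(N:ℝ)/2) := by ring
  rw [hC, gk, hN, Real.rpow_neg (by positivity), ← Real.inv_rpow (by positivity)]
  have : (4 * Real.pi * (t+τ)) ^ (-(N:ℝ)/2) = (4 * Real.pi * τ) ^ (-(N:ℝ)/2) *
      (4 * Real.pi * t) ^ (-(N:ℝ)/2) * (Real.pi / b)⁻¹ ^ (-(N:ℝ)/2) := by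
    rw [← Real.mul_rpow (by positivity) (by positivity),
      ← Real.mul_rpow (by positivity) (by positivity)]
    congr 1
    rw [hb]
    have : τ + t ≠ 0 := by positivity
    field_simp
    ring
  rw [this]; ring

/-- The constant in the power subordination formula. -/
def cg (N : ℕ) (γ : ℝ) : ℝ :=
  (4 * Real.pi) ^ (-(N:ℝ)/2) * 4 ^ ((N:ℝ)/2 - γ) * Real.Gamma ((N:ℝ)/2 - γ)

lemma cg_pos {N : ℕ} {γ : ℝ} (hγ : γ < N/2) : 0 < cg N γ := by
  have := Real.Gamma_pos_of_pos (s := (N:ℝ)/2 - γ) (by linarith)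
  have := Real.pi_pos
  unfold cg; positivity

/-- The functions `h_ε`. -/
def Hl (N : ℕ) (γ ε : ℝ) (x : EN N) : ENNReal :=
  ∫⁻ t in Ioi (0:ℝ), ENNReal.ofReal (t ^ (γ-1)) * ENNReal.ofReal (gk N (t+ε) x)

lemma lint_inv (F : ℝ → ENNReal) :
    ∫⁻ t in Ioi (0:ℝ), F t = ∫⁻ r in Ioi (0:ℝ), ENNReal.ofReal ((r^2)⁻¹) * F r⁻¹ := by
  have h := lintegral_image_eq_lintegral_abs_deriv_mul (s := Ioi (0:ℝ)) (f := fun r => r⁻¹)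
    (f' := fun r => -(r^2)⁻¹) measurableSet_Ioi
    (fun x hx => (hasDerivAt_inv (ne_of_gt hx)).hasDerivWithinAt)
    (fun x _ y _ h => by simpa using h) F
  have him : (fun r : ℝ => r⁻¹) '' Ioi (0:ℝ) = Ioi 0 := by
    ext y; constructor
    · rintro ⟨x, hx, rfl⟩
      exact mem_Ioi.2 (inv_pos.2 (mem_Ioi.1 hx))
    · intro hy
      exact ⟨y⁻¹, mem_Ioi.2 (inv_pos.2 (mem_Ioi.1 hy)), inv_inv y⟩
  rw [him] at h
  rw [h]
  refine setLIntegral_congr_fun measurableSet_Ioi fun r hr => ?_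
  rw [abs_neg, abs_of_nonneg (by positivity)]

lemma Hl_zero (N : ℕ) {γ : ℝ} (hγ : γ < N/2) {x : EN N} (hx : x ≠ 0) :
    Hl N γ 0 x = ENNReal.ofReal (cg N γ * ‖x‖ ^ (2*γ-N)) := by
  have hpi := Real.pi_pos
  have hxn : 0 < ‖x‖ := norm_pos_iff.2 hx
  have ha : 0 < (N:ℝ)/2 - γ := by linarith
  have hr : 0 < ‖x‖^2/4 := by positivity
  rw [Hl, lint_inv]
  have : ∀ r ∈ Ioi (0:ℝ), ENNReal.ofReal ((r^2)⁻¹) * (ENNReal.ofReal (r⁻¹ ^ (γ-1)) *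
      ENNReal.ofReal (gk N (r⁻¹+0) x)) = ENNReal.ofReal ((4 * Real.pi) ^ (-(N:ℝ)/2)) *
      ENNReal.ofReal (r ^ (((N:ℝ)/2 - γ)-1) * Real.exp (-(‖x‖^2/4*r))) := by
    intro r hr
    have hr : 0 < r := hr
    rw [← ENNReal.ofReal_mul (by positivity), ← ENNReal.ofReal_mul (by positivity),
      ← ENNReal.ofReal_mul (by positivity)]
    congr 1
    rw [gk, add_zero, Real.mul_rpow (by positivity) (by positivity)]
    have e1 : (r^2)⁻¹ = r ^ (-2:ℝ) := by rw [Real.rpow_neg hr.le]; norm_cast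
    have e2 : r⁻¹ ^ (γ-1) = r ^ (-(γ-1)) := by rw [Real.rpow_neg hr.le, Real.inv_rpow hr.le]
    have e3 : r⁻¹ ^ (-(N:ℝ)/2) = r ^ ((N:ℝ)/2) := by
      rw [neg_div, Real.rpow_neg (by positivity), Real.inv_rpow hr.le, inv_inv]
    have e4 : -‖x‖^2/(4*r⁻¹) = -(‖x‖^2/4*r) := by field_simp
    have e5 : r ^ (((N:ℝ)/2 - γ)-1) = r ^ (-2:ℝ) * r ^ (-(γ-1)) * r ^ ((N:ℝ)/2) := by
      rw [← Real.rpow_add hr, ← Real.rpow_add hr]; congr 1; ring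
    rw [e1, e2, e3, e4, e5]; ring
  rw [setLIntegral_congr_fun measurableSet_Ioi this,
    lintegral_const_mul' _ _ ENNReal.ofReal_ne_top, lint_gamma ha hr,
    ← ENNReal.ofReal_mul (by positivity)]
  congr 1
  have e6 : (1/(‖x‖^2/4)) ^ ((N:ℝ)/2 - γ) = 4 ^ ((N:ℝ)/2 - γ) * ‖x‖ ^ (2*γ-N) := by
    rw [show 1/(‖x‖^2/4) = 4 * (‖x‖^2)⁻¹ by field_simp,
      Real.mul_rpow (by positivity) (by positivity)]
    congr 1
    rw [← Real.rpow_natCast, ← Real.rpow_neg hxn.le, ← Real.rpow_mul hxn.le]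
    congr 1; push_cast; ring
  rw [e6, cg]; ring

lemma lint_dom (N : ℕ) {γ : ℝ} (h0 : 0 < γ) (hγ : γ < N/2) {C : ℝ} (hC : 0 ≤ C) :
    ∫⁻ t in Ioi (0:ℝ), ENNReal.ofReal (t ^ (γ-1)) * ENNReal.ofReal (min C (t ^ (-(N:ℝ)/2)))
      ≠ ⊤ := by
  have hsplit : Ioi (0:ℝ) = Ioc 0 1 ∪ Ioi 1 := (Ioc_union_Ioi_eq_Ioi zero_le_one).symm
  rw [hsplit]
  refine ne_top_of_le_ne_top ?_ (lintegral_union_le _ _ _)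
  refine ENNReal.add_ne_top.2 ⟨?_, ?_⟩
  · have hi : IntegrableOn (fun t : ℝ => t ^ (γ-1) * C) (Ioc 0 1) := by
      have := (intervalIntegral.intervalIntegrable_rpow' (a := 0) (b := 1) (r := γ-1)
        (by linarith)).1
      exact this.mul_const C
    refine ne_top_of_le_ne_top hi.lintegral_lt_top.ne ?_
    refine setLIntegral_mono' measurableSet_Ioc fun t ht => ?_
    have : 0 < t := ht.1
    rw [← ENNReal.ofReal_mul (by positivity)]
    apply ENNReal.ofReal_le_ofReal
    gcongr
    exact min_le_left _ _
  · have hi : IntegrableOn (fun t : ℝ => t ^ (γ-1-N/2)) (Ioi 1) :=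
      integrableOn_Ioi_rpow_of_lt (by linarith) one_pos
    refine ne_top_of_le_ne_top hi.lintegral_lt_top.ne ?_
    refine setLIntegral_mono' measurableSet_Ioi fun t ht => ?_
    have : 0 < t := zero_lt_one.trans ht
    rw [← ENNReal.ofReal_mul (by positivity)]
    apply ENNReal.ofReal_le_ofReal
    calc t ^ (γ-1) * min C (t ^ (-(N:ℝ)/2)) ≤ t ^ (γ-1) * t ^ (-(N:ℝ)/2) := by
          gcongr; exact min_le_right _ _
      _ = _ := by rw [← Real.rpow_add this]; congr 1; ring

lemma gk_le_rpow {N : ℕ} {t : ℝ} (ht : 0 < t) (x : EN N) : gk N t x ≤ t ^ (-(N:ℝ)/2) := by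
  have hpi := Real.pi_gt_three
  unfold gk
  have h1 : Real.exp (-‖x‖^2/(4*t)) ≤ 1 := by
    rw [Real.exp_le_one_iff, neg_div]
    have : 0 ≤ ‖x‖^2/(4*t) := by positivity
    linarith
  have h2 : (4 * Real.pi * t) ^ (-(N:ℝ)/2) ≤ t ^ (-(N:ℝ)/2) := by
    apply Real.rpow_le_rpow_of_nonpos ht (by nlinarith)
    have : (0:ℝ) ≤ N := by positivity
    linarith
  calc _ ≤ t ^ (-(N:ℝ)/2) * 1 := by gcongr
    _ = _ := mul_one _

lemma gk_le_min {N : ℕ} {t ε : ℝ} (ht : 0 < t) (hε : 0 ≤ ε) {C : ℝ} (x : EN N)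
    (hC : gk N (t+ε) x ≤ C) : gk N (t+ε) x ≤ min C (t ^ (-(N:ℝ)/2)) := by
  refine le_min hC ((gk_le_rpow (by linarith) x).trans ?_)
  apply Real.rpow_le_rpow_of_nonpos ht (by linarith)
  have : (0:ℝ) ≤ N := by positivity
  linarith

/-- uniform bound for `Hl` at positive `ε`. -/
def Mb (N : ℕ) (γ ε : ℝ) : ENNReal := ∫⁻ t in Ioi (0:ℝ), ENNReal.ofReal (t ^ (γ-1)) *
  ENNReal.ofReal (min (ε ^ (-(N:ℝ)/2)) (t ^ (-(N:ℝ)/2)))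

lemma Mb_ne_top (N : ℕ) {γ ε : ℝ} (h0 : 0 < γ) (hγ : γ < N/2) (hε : 0 < ε) : Mb N γ ε ≠ ⊤ :=
  lint_dom N h0 hγ (by positivity)

lemma Hl_le (N : ℕ) {γ ε : ℝ} (hε : 0 < ε) (x : EN N) : Hl N γ ε x ≤ Mb N γ ε := by
  refine setLIntegral_mono' measurableSet_Ioi fun t ht => ?_
  have ht : 0 < t := ht
  gcongr
  apply gk_le_min ht hε.le
  refine (gk_le_rpow (by linarith) x).trans ?_
  apply Real.rpow_le_rpow_of_nonpos hε (by linarith)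
  have : (0:ℝ) ≤ N := by positivity
  linarith

lemma gk_bdd {N : ℕ} {x : EN N} (hx : x ≠ 0) : ∃ C : ℝ, 0 ≤ C ∧ ∀ t : ℝ, 0 < t → gk N t x ≤ C := by
  have hxn : 0 < ‖x‖ := norm_pos_iff.2 hx
  have hpi := Real.pi_pos
  set A := (Real.pi * ‖x‖^2) ^ (-(N:ℝ)/2)
  refine ⟨A * (1 + N.factorial), by positivity, fun t ht => ?_⟩
  set y := ‖x‖^2/(4*t) with hy
  have hypos : 0 < y := by positivity
  have e1 : gk N t x = A * (y ^ ((N:ℝ)/2) * Real.exp (-y)) := by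
    have : 4 * Real.pi * t = (Real.pi * ‖x‖^2) * y⁻¹ := by rw [hy]; field_simp
    rw [gk, this, Real.mul_rpow (by positivity) (by positivity), neg_div (2:ℝ) (N:ℝ),
      Real.rpow_neg (x := y⁻¹) (by positivity), Real.inv_rpow hypos.le, inv_inv,
      neg_div (4*t), ← hy]
    simp only [A]
    rw [neg_div (2:ℝ) (N:ℝ)]; ring
  rw [e1]
  gcongr
  rw [Real.exp_neg, ← div_eq_mul_inv, div_le_iff₀ (Real.exp_pos _)]
  have h1 : y ^ ((N:ℝ)/2) ≤ 1 + y ^ N := by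
    rcases le_total y 1 with h | h
    · have : y ^ ((N:ℝ)/2) ≤ 1 := Real.rpow_le_one hypos.le h (by positivity)
      have : 0 < y ^ N := by positivity
      linarith
    · have : y ^ ((N:ℝ)/2) ≤ y ^ (N:ℝ) := by
        apply Real.rpow_le_rpow_of_exponent_le h
        have : (0:ℝ) ≤ N := by positivity
        linarith
      rw [Real.rpow_natCast] at this
      linarith
  have h2 := Real.pow_div_factorial_le_exp y hypos.le N
  rw [div_le_iff₀ (by positivity)] at h2
  have h3 : 1 ≤ Real.exp y := Real.one_le_exp hypos.le
  nlinarith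

lemma tendsto_Hl (N : ℕ) {γ : ℝ} (h0 : 0 < γ) (hγ : γ < N/2) {x : EN N} (hx : x ≠ 0)
    (e : ℕ → ℝ) (he0 : ∀ n, 0 < e n) (he : Tendsto e atTop (𝓝 0)) :
    Tendsto (fun n => Hl N γ (e n) x) atTop (𝓝 (Hl N γ 0 x)) := by
  obtain ⟨C, hC0, hC⟩ := gk_bdd hx
  refine tendsto_lintegral_of_dominated_convergence
    (fun t => ENNReal.ofReal (t ^ (γ-1)) * ENNReal.ofReal (min C (t ^ (-(N:ℝ)/2))))
    (fun n => by fun_prop) (fun n => ?_) (lint_dom N h0 hγ hC0) ?_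
  · filter_upwards [ae_restrict_mem measurableSet_Ioi] with t ht
    have ht : 0 < t := ht
    gcongr
    exact gk_le_min ht (he0 n).le x (hC _ (by linarith [he0 n]))
  · filter_upwards [ae_restrict_mem measurableSet_Ioi] with t ht
    have ht : 0 < t := ht
    apply ENNReal.Tendsto.const_mul _ (Or.inr ENNReal.ofReal_ne_top)
    apply ENNReal.tendsto_ofReal
    have hc : ContinuousAt (fun r => gk N r x) (t+0) := by
      have hpi := Real.pi_pos
      have h1 : 4 * Real.pi * (t+0) ≠ 0 := by rw [add_zero]; positivity
      have h2 : 4 * (t+0) ≠ 0 := by rw [add_zero]; positivity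
      unfold gk
      exact ((by fun_prop : ContinuousAt (fun r => 4 * Real.pi * r) (t+0)).rpow_const
        (Or.inl h1)).mul (Real.continuous_exp.continuousAt.comp
          (ContinuousAt.div (by fun_prop) (by fun_prop) h2))
    exact hc.tendsto.comp (tendsto_const_nhds.add he)

lemma measurable_Hl (N : ℕ) (γ ε : ℝ) : Measurable (Hl N γ ε) :=
  Measurable.lintegral_prod_right'
    (f := fun p : EN N × ℝ => ENNReal.ofReal (p.2 ^ (γ-1)) * ENNReal.ofReal (gk N (p.2+ε) p.1))
    (by fun_prop)

lemma Hl_semigroup (N : ℕ) {γ ε τ : ℝ} (hε : 0 < ε) (hτ : 0 < τ) (x : EN N) :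
    ∫⁻ y : EN N, ENNReal.ofReal (gk N τ (x-y)) * Hl N γ ε y = Hl N γ (ε+τ) x := by
  have hm : Measurable (fun p : EN N × ℝ => ENNReal.ofReal (gk N τ (x-p.1)) *
      (ENNReal.ofReal (p.2 ^ (γ-1)) * ENNReal.ofReal (gk N (p.2+ε) p.1))) := by fun_prop
  calc _ = ∫⁻ y : EN N, ∫⁻ t in Ioi (0:ℝ), ENNReal.ofReal (gk N τ (x-y)) *
      (ENNReal.ofReal (t ^ (γ-1)) * ENNReal.ofReal (gk N (t+ε) y)) := by
        congr 1; ext y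
        rw [lintegral_const_mul' _ _ ENNReal.ofReal_ne_top, Hl]
    _ = ∫⁻ t in Ioi (0:ℝ), ∫⁻ y : EN N, ENNReal.ofReal (gk N τ (x-y)) *
      (ENNReal.ofReal (t ^ (γ-1)) * ENNReal.ofReal (gk N (t+ε) y)) :=
        lintegral_lintegral_swap hm.aemeasurable
    _ = _ := by
        rw [Hl]
        refine setLIntegral_congr_fun measurableSet_Ioi fun t ht => ?_
        have ht : 0 < t := ht
        simp only [mul_left_comm (ENNReal.ofReal (gk N τ (x-_)))]
        rw [lintegral_const_mul' _ _ ENNReal.ofReal_ne_top, lint_conv N hτ (by linarith), add_assoc]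

lemma Hl_lower (N : ℕ) {γ ε ρ : ℝ} (hε : 0 < ε) :
    ∃ c : ENNReal, 0 < c ∧ ∀ x : EN N, ‖x‖ ≤ ρ → c ≤ Hl N γ ε x := by
  have hpi := Real.pi_pos
  set d := (4 * Real.pi * (2+ε)) ^ (-(N:ℝ)/2) * Real.exp (-ρ^2/(4*ε)) with hd
  have hdpos : 0 < d := by positivity
  refine ⟨∫⁻ t in Ioo (1:ℝ) 2, ENNReal.ofReal (t ^ (γ-1)) * ENNReal.ofReal d, ?_, fun x hx => ?_⟩
  · rw [lintegral_pos_iff_support (by fun_prop)]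
    have : Ioo (1:ℝ) 2 ⊆ Function.support
        (fun t => ENNReal.ofReal (t ^ (γ-1)) * ENNReal.ofReal d) := by
      intro t ht
      have : 0 < t := zero_lt_one.trans ht.1
      have h1 : 0 < t ^ (γ-1) := by positivity
      simp [h1, hdpos]
    refine lt_of_lt_of_le ?_ (measure_mono this)
    rw [Measure.restrict_apply_self]; simp
  · refine le_trans ?_ (lintegral_mono_set (s := Ioo (1:ℝ) 2)
      (fun t ht => zero_lt_one.trans ht.1))
    refine setLIntegral_mono' measurableSet_Ioo fun t ht => ?_
    have ht0 : 0 < t := zero_lt_one.trans ht.1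
    gcongr
    rw [hd, gk]
    apply mul_le_mul _ _ (by positivity) (by positivity)
    · apply Real.rpow_le_rpow_of_nonpos (by positivity)
      · have := ht.2; gcongr
      · have : (0:ℝ) ≤ N := by positivity
        linarith
    · apply Real.exp_le_exp.2
      rw [neg_div, neg_div, neg_le_neg_iff]
      gcongr
      linarith

/-! ### The ground state representation -/

/-- Numerator of the remainder. -/
def Rem {N : ℕ} (h v : EN N → ℝ) (p : EN N × EN N) : ℝ :=
  h p.1 * h p.2 * (v p.1 / h p.1 - v p.2 / h p.2)^2

lemma subord (N : ℕ) {s : ℝ} (hs0 : 0 < s) (S : EN N × EN N → ℝ) (hSm : Measurable S)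
    (hS0 : ∀ p, 0 ≤ S p) (hSd : ∀ x, S (x, x) = 0) :
    ∫⁻ τ in Ioi (0:ℝ), ENNReal.ofReal (τ ^ (-1-s)) *
        ∫⁻ p : EN N × EN N, ENNReal.ofReal (gk N τ (p.1-p.2)) * ENNReal.ofReal (S p) =
      ENNReal.ofReal (cg N (-s)) *
        ∫⁻ p : EN N × EN N, ENNReal.ofReal (S p / dist p.1 p.2 ^ ((N:ℝ)+2*s)) := by
  have hlt : -s < (N:ℝ)/2 := by
    have : (0:ℝ) ≤ N := by positivity
    linarith
  have hm : Measurable (fun q : ℝ × (EN N × EN N) => ENNReal.ofReal (q.1 ^ (-1-s)) *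
      (ENNReal.ofReal (gk N q.1 (q.2.1-q.2.2)) * ENNReal.ofReal (S q.2))) := by fun_prop
  calc _ = ∫⁻ τ in Ioi (0:ℝ), ∫⁻ p : EN N × EN N, ENNReal.ofReal (τ ^ (-1-s)) *
        (ENNReal.ofReal (gk N τ (p.1-p.2)) * ENNReal.ofReal (S p)) := by
        congr 1; ext τ
        rw [lintegral_const_mul' _ _ ENNReal.ofReal_ne_top]
    _ = ∫⁻ p : EN N × EN N, ∫⁻ τ in Ioi (0:ℝ), ENNReal.ofReal (τ ^ (-1-s)) *
        (ENNReal.ofReal (gk N τ (p.1-p.2)) * ENNReal.ofReal (S p)) :=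
        lintegral_lintegral_swap hm.aemeasurable
    _ = _ := by
        rw [← lintegral_const_mul' _ _ ENNReal.ofReal_ne_top]
        congr 1; ext p
        by_cases hp : p.1 = p.2
        · have : S p = 0 := by
            have := hSd p.1
            rwa [show (p.1, p.1) = p from Prod.ext rfl hp] at this
          simp [this]
        · have hz := Hl_zero N hlt (sub_ne_zero.2 hp)
          rw [Hl] at hz
          simp only [← mul_assoc]
          rw [lintegral_mul_const _ (by fun_prop)]
          have e : ∫⁻ τ in Ioi (0:ℝ), ENNReal.ofReal (τ ^ (-1-s)) *
              ENNReal.ofReal (gk N τ (p.1-p.2)) =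
              ENNReal.ofReal (cg N (-s) * ‖p.1-p.2‖ ^ (2*(-s)-N)) := by
            rw [← hz]
            congr 1; ext τ
            rw [add_zero, show -1-s = -s-1 by ring]
          have hd : 0 < dist p.1 p.2 := dist_pos.2 hp
          rw [e, ← ENNReal.ofReal_mul (by have := (cg_pos hlt).le; positivity),
            ← ENNReal.ofReal_mul (cg_pos hlt).le]
          congr 1
          rw [← dist_eq_norm, show 2*(-s)-(N:ℝ) = -((N:ℝ)+2*s) by ring, Real.rpow_neg hd.le]
          ring

lemma hardy_eps (N : ℕ) {s : ℝ} (hs0 : 0 < s) (hs1 : s < 1) (hN : 2 ≤ N) {ε : ℝ} (hε : 0 < ε)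
    (v : EN N → ℝ) (hv : Measurable v) {ρ : ℝ} (hsupp : ∀ x, ρ < ‖x‖ → v x = 0)
    (hv2 : ∫⁻ x, ENNReal.ofReal (v x ^ 2) ≠ ⊤) :
    ENNReal.ofReal (cg N (-s)) * ∫⁻ p : EN N × EN N,
        ENNReal.ofReal ((v p.1 - v p.2)^2 / dist p.1 p.2 ^ ((N:ℝ)+2*s)) =
    ENNReal.ofReal (cg N (-s)) * (∫⁻ p : EN N × EN N,
        ENNReal.ofReal (Rem (fun x => (Hl N ((N+2*s)/4) ε x).toReal) v p /
          dist p.1 p.2 ^ ((N:ℝ)+2*s))) +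
    2 * ENNReal.ofReal (Kc ((N+2*s)/4) s) * ∫⁻ x : EN N,
        ENNReal.ofReal (v x ^2 / (Hl N ((N+2*s)/4) ε x).toReal *
          (Hl N ((N+2*s)/4 - s) ε x).toReal) := by
  have hNr : (2:ℝ) ≤ N := by exact_mod_cast hN
  set β : ℝ := (N+2*s)/4 with hβ
  have hβ0 : 0 < β := by rw [hβ]; linarith
  have hβs : s < β := by rw [hβ]; linarith
  have hβN : β < N/2 := by rw [hβ]; linarith
  have hfin : ∀ x, Hl N β ε x ≠ ⊤ := fun x =>
    ne_top_of_le_ne_top (Mb_ne_top N hβ0 hβN hε) (Hl_le N hε x)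
  have hfin' : ∀ x, Hl N (β-s) ε x ≠ ⊤ := fun x =>
    ne_top_of_le_ne_top (Mb_ne_top N (by linarith) (by linarith) hε) (Hl_le N hε x)
  set h : EN N → ℝ := fun x => (Hl N β ε x).toReal with hh
  have hhm : Measurable h := (measurable_Hl N β ε).ennreal_toReal
  have hpos : ∀ x, 0 < h x := by
    intro x
    obtain ⟨c, hc, hle⟩ := Hl_lower N (γ := β) (ρ := ‖x‖) hε
    exact ENNReal.toReal_pos (hc.trans_le (hle x le_rfl)).ne' (hfin x)
  have hofh : ∀ x, ENNReal.ofReal (h x) = Hl N β ε x := fun x => ENNReal.ofReal_toReal (hfin x)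
  set g : EN N → ℝ := fun x => v x ^ 2 / h x with hg
  have hgm : Measurable g := by fun_prop
  have hg0 : ∀ x, 0 ≤ g x := fun x => by have := hpos x; simp only [hg]; positivity
  have hgh : ∀ x, g x * h x = v x ^ 2 := fun x => by
    have := (hpos x).ne'; simp only [hg]; field_simp
  have hRm : Measurable (Rem h v) := by unfold Rem; fun_prop
  have hR0 : ∀ p, 0 ≤ Rem h v p := fun p => by
    have := hpos p.1; have := hpos p.2; unfold Rem; positivity
  set f : ℝ → ENNReal := fun t => ∫⁻ x, ENNReal.ofReal (g x) * ENNReal.ofReal (gk N (t+ε) x) with hf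
  have hfm : Measurable f := Measurable.lintegral_prod_right'
    (f := fun p : ℝ × EN N => ENNReal.ofReal (g p.2) * ENNReal.ofReal (gk N (p.1+ε) p.2))
    (by fun_prop)
  have F1 : ∀ γ τ : ℝ, ∫⁻ t in Ioi (0:ℝ), ENNReal.ofReal (t ^ (γ-1)) * f (t+τ) =
      ∫⁻ x, ENNReal.ofReal (g x) * Hl N γ (ε+τ) x := by
    intro γ τ
    have hm : Measurable (fun q : ℝ × EN N => ENNReal.ofReal (q.1 ^ (γ-1)) *
      (ENNReal.ofReal (g q.2) * ENNReal.ofReal (gk N (q.1+τ+ε) q.2))) := by fun_prop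
    calc _ = ∫⁻ t in Ioi (0:ℝ), ∫⁻ x, ENNReal.ofReal (t ^ (γ-1)) *
        (ENNReal.ofReal (g x) * ENNReal.ofReal (gk N (t+τ+ε) x)) := by
          congr 1; ext t
          rw [lintegral_const_mul' _ _ ENNReal.ofReal_ne_top]
      _ = ∫⁻ x, ∫⁻ t in Ioi (0:ℝ), ENNReal.ofReal (t ^ (γ-1)) *
        (ENNReal.ofReal (g x) * ENNReal.ofReal (gk N (t+τ+ε) x)) :=
          lintegral_lintegral_swap hm.aemeasurable
      _ = _ := by
          congr 1; ext x
          rw [Hl, ← lintegral_const_mul' _ _ ENNReal.ofReal_ne_top]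
          congr 1; ext t
          rw [show t + τ + ε = t + (ε + τ) by ring]; ring
  have hb : ∫⁻ t in Ioi (0:ℝ), ENNReal.ofReal (t ^ (β-1)) * f t =
      ∫⁻ x, ENNReal.ofReal (v x ^ 2) := by
    have := F1 β 0
    simp only [add_zero] at this
    rw [this]
    congr 1; ext x
    rw [← hofh, ← ENNReal.ofReal_mul (hg0 x), hgh]
  have hIeq : ∫⁻ t in Ioi (0:ℝ), ENNReal.ofReal (t ^ (β-1-s)) * f t =
      ∫⁻ x, ENNReal.ofReal (g x * (Hl N (β-s) ε x).toReal) := by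
    have := F1 (β-s) 0
    simp only [add_zero] at this
    rw [show β-1-s = β-s-1 by ring, this]
    congr 1; ext x
    rw [ENNReal.ofReal_mul (hg0 x), ENNReal.ofReal_toReal (hfin' x)]
  have hI : ∫⁻ t in Ioi (0:ℝ), ENNReal.ofReal (t ^ (β-1-s)) * f t ≠ ⊤ := by
    rw [hIeq]
    obtain ⟨c, hc, hle⟩ := Hl_lower N (γ := β) (ρ := ρ) hε
    have hM := Mb_ne_top N (γ := β-s) (by linarith) (by linarith) hε
    have hctop : c⁻¹ ≠ ⊤ := by simpa using hc.ne'
    have hbound : ∫⁻ x, ENNReal.ofReal (g x * (Hl N (β-s) ε x).toReal) ≤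
        ∫⁻ x, (c⁻¹ * Mb N (β-s) ε) * ENNReal.ofReal (v x ^ 2) := by
      refine lintegral_mono fun x => ?_
      by_cases hx : ρ < ‖x‖
      · simp [hg, hsupp x hx]
      · rw [ENNReal.ofReal_mul (hg0 x), ENNReal.ofReal_toReal (hfin' x)]
        have : ENNReal.ofReal (g x) ≤ c⁻¹ * ENNReal.ofReal (v x ^ 2) := by
          simp only [hg]
          rw [ENNReal.ofReal_div_of_pos (hpos x), hofh, ENNReal.div_eq_inv_mul]
          gcongr
          exact hle x (not_lt.1 hx)
        calc _ ≤ (c⁻¹ * ENNReal.ofReal (v x ^ 2)) * Mb N (β-s) ε := by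
              gcongr
              exact Hl_le N hε x
          _ = _ := by ring
    refine ne_top_of_le_ne_top ?_ hbound
    rw [lintegral_const_mul' _ _ (ENNReal.mul_ne_top hctop hM)]
    exact ENNReal.mul_ne_top (ENNReal.mul_ne_top hctop hM) hv2
  set D : ℝ → ENNReal := fun τ => ∫⁻ p : EN N × EN N, ENNReal.ofReal (gk N τ (p.1-p.2)) *
    ENNReal.ofReal ((v p.1 - v p.2)^2) with hD
  set R : ℝ → ENNReal := fun τ => ∫⁻ p : EN N × EN N, ENNReal.ofReal (gk N τ (p.1-p.2)) *
    ENNReal.ofReal (Rem h v p) with hR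
  have hDm : Measurable D := Measurable.lintegral_prod_right'
    (f := fun q : ℝ × (EN N × EN N) => ENNReal.ofReal (gk N q.1 (q.2.1-q.2.2)) *
    ENNReal.ofReal ((v q.2.1 - v q.2.2)^2)) (by fun_prop)
  have hRRm : Measurable R := Measurable.lintegral_prod_right'
    (f := fun q : ℝ × (EN N × EN N) => ENNReal.ofReal (gk N q.1 (q.2.1-q.2.2)) *
    ENNReal.ofReal (Rem h v q.2)) (by fun_prop)
  have hsymm : ∀ τ (x y : EN N), gk N τ (x-y) = gk N τ (y-x) := fun τ x y => by
    unfold gk; rw [norm_sub_rev]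
  have key : ∀ τ : ℝ, 0 < τ →
      D τ + 2 * ∫⁻ t in Ioi (0:ℝ), ENNReal.ofReal (cut β (t-τ)) * f t =
      R τ + 2 * ∫⁻ t in Ioi (0:ℝ), ENNReal.ofReal (t ^ (β-1)) * f t := by
    intro τ hτ
    rw [lint_shift β f hτ, F1 β τ, hb]
    have G1 : ∫⁻ p : EN N × EN N, ENNReal.ofReal (gk N τ (p.1-p.2)) *
        ENNReal.ofReal (g p.1 * h p.2) = ∫⁻ x, ENNReal.ofReal (g x) * Hl N β (ε+τ) x := by
      rw [Measure.volume_eq_prod, lintegral_prod _ (by fun_prop)]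
      congr 1; ext x
      rw [← Hl_semigroup N hε hτ, ← lintegral_const_mul' _ _ ENNReal.ofReal_ne_top]
      congr 1; ext y
      rw [ENNReal.ofReal_mul (hg0 x), hofh]; ring
    have G2 : ∫⁻ p : EN N × EN N, ENNReal.ofReal (gk N τ (p.1-p.2)) *
        ENNReal.ofReal (g p.2 * h p.1) = ∫⁻ x, ENNReal.ofReal (g x) * Hl N β (ε+τ) x := by
      rw [← G1, Measure.volume_eq_prod, ← lintegral_prod_swap]
      congr 1; ext p
      simp only [Prod.fst_swap, Prod.snd_swap]
      rw [hsymm]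
    have G3 : ∫⁻ p : EN N × EN N, ENNReal.ofReal (gk N τ (p.1-p.2)) *
        ENNReal.ofReal (v p.2 ^ 2) = ∫⁻ x, ENNReal.ofReal (v x ^ 2) := by
      rw [Measure.volume_eq_prod, lintegral_prod_symm' _ (by fun_prop)]
      congr 1; ext y
      show ∫⁻ x : EN N, ENNReal.ofReal (gk N τ (x - y)) * ENNReal.ofReal (v y ^ 2) =
        ENNReal.ofReal (v y ^ 2)
      rw [lintegral_mul_const _ (by fun_prop),
        lintegral_sub_right_eq_self (fun z : EN N => ENNReal.ofReal (gk N τ z)), lint_gk N hτ,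
        one_mul]
    have G4 : ∫⁻ p : EN N × EN N, ENNReal.ofReal (gk N τ (p.1-p.2)) *
        ENNReal.ofReal (v p.1 ^ 2) = ∫⁻ x, ENNReal.ofReal (v x ^ 2) := by
      rw [← G3, Measure.volume_eq_prod, ← lintegral_prod_swap]
      congr 1; ext p
      simp only [Prod.fst_swap, Prod.snd_swap]
      rw [hsymm]
    rw [two_mul, two_mul]
    nth_rewrite 1 [← G1]
    rw [← G2]
    nth_rewrite 1 [← G3]
    rw [← G4, hD, hR]
    simp only
    rw [← lintegral_add_left (by fun_prop), ← lintegral_add_left (by fun_prop),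
      ← lintegral_add_left (by fun_prop), ← lintegral_add_left (by fun_prop)]
    congr 1; ext p
    simp only [← mul_add]
    congr 1
    have a1 := hpos p.1
    have a2 := hpos p.2
    have a3 := hg0 p.1
    have a4 := hg0 p.2
    rw [← ENNReal.ofReal_add (by positivity) (by positivity),
      ← ENNReal.ofReal_add (by positivity) (by positivity),
      ← ENNReal.ofReal_add (by positivity) (by positivity),
      ← ENNReal.ofReal_add (hR0 p) (by positivity)]
    congr 1
    simp only [hg, Rem]
    field_simp
    ring
  have main := oneD hs0 hs1 hβs D R f hDm hRRm hfm (by rw [hb]; exact hv2) hI key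
  rw [hIeq] at main
  rw [← subord N hs0 (fun p => (v p.1 - v p.2)^2) (by fun_prop) (fun p => by positivity)
      (fun x => by simp),
    ← subord N hs0 (Rem h v) hRm hR0 (fun x => by simp [Rem])]
  exact main

lemma add_liminf_le (a b : ℕ → ENNReal) (T : ENNReal) (h : ∀ n, a n + b n ≤ T) :
    liminf a atTop + liminf b atTop ≤ T := by
  rw [liminf_eq_iSup_iInf_of_nat, liminf_eq_iSup_iInf_of_nat,
    ENNReal.iSup_add_iSup_of_monotone]
  · refine iSup_le fun n => le_trans (add_le_add (iInf₂_le n le_rfl) (iInf₂_le n le_rfl)) (h n)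
  · intro i j hij
    exact iInf_mono fun k => iInf_mono' fun hk => ⟨le_trans hij hk, le_rfl⟩
  · intro i j hij
    exact iInf_mono fun k => iInf_mono' fun hk => ⟨le_trans hij hk, le_rfl⟩

lemma fatou_tendsto {α : Type*} [MeasurableSpace α] {m : Measure α} (f : ℕ → α → ENNReal)
    (g : α → ENNReal) (hf : ∀ n, Measurable (f n))
    (hg : ∀ᵐ x ∂m, Tendsto (fun n => f n x) atTop (𝓝 (g x))) :
    ∫⁻ x, g x ∂m ≤ liminf (fun n => ∫⁻ x, f n x ∂m) atTop := by
  refine le_trans (le_of_eq ?_) (lintegral_liminf_le hf)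
  refine lintegral_congr_ae ?_
  filter_upwards [hg] with x hx
  exact hx.liminf_eq.symm

/-- Hardy inequality with remainder, raw constants. -/
lemma hardy_raw (N : ℕ) {s : ℝ} (hs0 : 0 < s) (hs1 : s < 1) (hN : 2 ≤ N)
    (v : EN N → ℝ) (hv : Measurable v) {ρ : ℝ} (hsupp : ∀ x, ρ < ‖x‖ → v x = 0)
    (hv2 : ∫⁻ x, ENNReal.ofReal (v x ^ 2) ≠ ⊤) :
    ENNReal.ofReal (cg N (-s)) * (∫⁻ p : EN N × EN N,
        ENNReal.ofReal (Rem (fun x => cg N ((N+2*s)/4) * ‖x‖ ^ (2*((N+2*s)/4)-N)) v p /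
          dist p.1 p.2 ^ ((N:ℝ)+2*s))) +
    2 * ENNReal.ofReal (Kc ((N+2*s)/4) s) * ∫⁻ x : EN N,
        ENNReal.ofReal (v x ^2 / (cg N ((N+2*s)/4) * ‖x‖ ^ (2*((N+2*s)/4)-N)) *
          (cg N ((N+2*s)/4-s) * ‖x‖ ^ (2*((N+2*s)/4-s)-N))) ≤
    ENNReal.ofReal (cg N (-s)) * ∫⁻ p : EN N × EN N,
        ENNReal.ofReal ((v p.1 - v p.2)^2 / dist p.1 p.2 ^ ((N:ℝ)+2*s)) := by
  have hNr : (2:ℝ) ≤ N := by exact_mod_cast hN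
  have : NeZero N := ⟨by omega⟩
  have hnt : Nontrivial (EN N) := by
    have : Nonempty (Fin N) := ⟨0⟩
    infer_instance
  set β : ℝ := (N+2*s)/4 with hβ
  have hβ0 : 0 < β := by rw [hβ]; linarith
  have hβs : 0 < β - s := by rw [hβ]; linarith
  have hβN : β < N/2 := by rw [hβ]; linarith
  have hβN' : β - s < N/2 := by linarith
  set e : ℕ → ℝ := fun n => 1/((n:ℝ)+1) with he
  have he0 : ∀ n, 0 < e n := fun n => by simp only [he]; positivity
  have het : Tendsto e atTop (𝓝 0) := tendsto_one_div_add_atTop_nhds_zero_nat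
  have hT : ∀ γ : ℝ, 0 < γ → γ < N/2 → ∀ x : EN N, x ≠ 0 →
      Tendsto (fun n => (Hl N γ (e n) x).toReal) atTop (𝓝 (cg N γ * ‖x‖ ^ (2*γ-N))) := by
    intro γ h0 h1 x hx
    have h := tendsto_Hl N h0 h1 hx e he0 het
    rw [Hl_zero N h1 hx] at h
    have h2 := (ENNReal.tendsto_toReal ENNReal.ofReal_ne_top).comp h
    rwa [ENNReal.toReal_ofReal (by have := cg_pos (N := N) h1; positivity)] at h2
  have hpos : ∀ γ : ℝ, γ < N/2 → ∀ x : EN N, x ≠ 0 → 0 < cg N γ * ‖x‖ ^ (2*γ-N) := by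
    intro γ h1 x hx
    have := cg_pos (N := N) h1
    have := norm_pos_iff.2 hx
    positivity
  have hae : ∀ᵐ x : EN N, x ≠ 0 := by
    simp [ae_iff]
  have hae2 : ∀ᵐ p : EN N × EN N, p.1 ≠ 0 ∧ p.2 ≠ 0 := by
    rw [Measure.volume_eq_prod]
    exact (Measure.quasiMeasurePreserving_fst.ae hae).and
      (Measure.quasiMeasurePreserving_snd.ae hae)
  have hHm : ∀ γ n, Measurable (fun x : EN N => (Hl N γ (e n) x).toReal) := fun γ n =>
    (measurable_Hl N γ (e n)).ennreal_toReal
  have F1 := fatou_tendsto (m := (volume : Measure (EN N × EN N)))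
    (fun n p => ENNReal.ofReal (Rem (fun x => (Hl N β (e n) x).toReal) v p /
          dist p.1 p.2 ^ ((N:ℝ)+2*s)))
    (fun p => ENNReal.ofReal (Rem (fun x => cg N β * ‖x‖ ^ (2*β-N)) v p /
          dist p.1 p.2 ^ ((N:ℝ)+2*s))) (by
      intro n
      have h0 := hHm β n
      have h1 : Measurable (fun p : EN N × EN N => (Hl N β (e n) p.1).toReal) :=
        h0.comp measurable_fst
      have h2 : Measurable (fun p : EN N × EN N => (Hl N β (e n) p.2).toReal) :=
        h0.comp measurable_snd
      unfold Rem
      fun_prop) (by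
      filter_upwards [hae2] with p hp
      refine ENNReal.tendsto_ofReal (Tendsto.div_const ?_ _)
      have t1 := hT β hβ0 hβN p.1 hp.1
      have t2 := hT β hβ0 hβN p.2 hp.2
      have q1 := (hpos β hβN p.1 hp.1).ne'
      have q2 := (hpos β hβN p.2 hp.2).ne'
      exact (t1.mul t2).mul (((tendsto_const_nhds.div t1 q1).sub (tendsto_const_nhds.div t2 q2)).pow 2))
  have F2 := fatou_tendsto (m := (volume : Measure (EN N)))
    (fun n x => ENNReal.ofReal (v x ^2 / (Hl N β (e n) x).toReal *
          (Hl N (β - s) (e n) x).toReal))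
    (fun x => ENNReal.ofReal (v x ^2 / (cg N β * ‖x‖ ^ (2*β-N)) *
          (cg N (β-s) * ‖x‖ ^ (2*(β-s)-N)))) (by
      intro n
      have h0 := hHm β n
      have h1 := hHm (β-s) n
      fun_prop) (by
      filter_upwards [hae] with x hx
      refine ENNReal.tendsto_ofReal ?_
      exact (tendsto_const_nhds.div (hT β hβ0 hβN x hx) (hpos β hβN x hx).ne').mul (hT _ hβs hβN' x hx))
  refine le_trans (add_le_add (mul_le_mul_right F1 _) (mul_le_mul_right F2 _)) ?_
  rw [← ENNReal.liminf_const_mul_of_ne_top ENNReal.ofReal_ne_top,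
    ← ENNReal.liminf_const_mul_of_ne_top (ENNReal.mul_ne_top (by simp) ENNReal.ofReal_ne_top)]
  refine add_liminf_le _ _ _ fun n => le_of_eq ?_
  exact (hardy_eps N hs0 hs1 hN (he0 n) v hv hsupp hv2).symm

lemma CNs_pos (N : ℕ) {s : ℝ} (hs0 : 0 < s) (hs1 : s < 1) : 0 < CNs N s := by
  have h1 := Real.Gamma_pos_of_pos (s := ((N:ℝ)+2*s)/2) (by positivity)
  have h2 := Real.Gamma_pos_of_pos (s := 1-s) (by linarith)
  have := Real.pi_pos
  unfold CNs; positivity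

lemma mu0_neg {N : ℕ} (hN : 2 ≤ N) {s : ℝ} (hs0 : 0 < s) (hs1 : s < 1) : mu0 N s < 0 := by
  have hNr : (2:ℝ) ≤ N := by exact_mod_cast hN
  have h1 := Real.Gamma_pos_of_pos (s := ((N:ℝ)+2*s)/4) (by positivity)
  have h2 := Real.Gamma_pos_of_pos (s := ((N:ℝ)-2*s)/4) (by linarith)
  unfold mu0
  have : 0 < 2 ^ (2*s) * Real.Gamma ((N + 2*s)/4) ^ 2 / Real.Gamma ((N - 2*s)/4) ^ 2 := by
    positivity
  linarith

lemma CNs_eq (N : ℕ) {s : ℝ} (hs0 : 0 < s) (hs1 : s < 1) :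
    s / (2 * Real.Gamma (1-s)) * cg N (-s) = CNs N s / 2 := by
  have h2 := Real.Gamma_pos_of_pos (s := 1-s) (by linarith)
  have hpi := Real.pi_pos
  have e1 : (4 * Real.pi) ^ (-(N:ℝ)/2) * 4 ^ ((N:ℝ)/2 - -s) = 2 ^ (2*s) * Real.pi ^ (-(N:ℝ)/2) := by
    rw [Real.mul_rpow (by norm_num) hpi.le, mul_right_comm,
      ← Real.rpow_add (by norm_num), show (4:ℝ) = 2 ^ (2:ℝ) by norm_num, ← Real.rpow_mul (by norm_num)]
    congr 2
    ring
  rw [cg, e1, CNs, show (N:ℝ)/2 - -s = (N+2*s)/2 by ring]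
  field_simp

lemma mu0_eq {N : ℕ} (hN : 2 ≤ N) {s : ℝ} (hs0 : 0 < s) (hs1 : s < 1) :
    s / (2 * Real.Gamma (1-s)) * (2 * Kc ((N+2*s)/4) s *
      (cg N ((N+2*s)/4-s) / cg N ((N+2*s)/4))) = - mu0 N s := by
  have hNr : (2:ℝ) ≤ N := by exact_mod_cast hN
  have h2 := Real.Gamma_pos_of_pos (s := 1-s) (by linarith)
  have hpi := Real.pi_pos
  have h3 := Real.Gamma_pos_of_pos (s := ((N:ℝ)+2*s)/4) (by positivity)
  have h4 := Real.Gamma_pos_of_pos (s := ((N:ℝ)-2*s)/4) (by linarith)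
  have e1 : (N:ℝ)/2 - (N+2*s)/4 = (N-2*s)/4 := by ring
  have e2 : (N:ℝ)/2 - ((N+2*s)/4-s) = (N+2*s)/4 := by ring
  have e3 : (N+2*s)/4-s = (N-2*s)/4 := by ring
  have e4 : (4:ℝ) ^ ((N+2*s)/4) = 2 ^ (2*s) * 4 ^ (((N:ℝ)-2*s)/4) := by
    rw [show (4:ℝ) = 2 ^ (2:ℝ) by norm_num, ← Real.rpow_mul (by norm_num),
      ← Real.rpow_mul (by norm_num), ← Real.rpow_add (by norm_num)]
    congr 1; ring
  have h5 : (0:ℝ) < (4 * Real.pi) ^ (-(N:ℝ)/2) := by positivity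
  have h6 : (0:ℝ) < 4 ^ (((N:ℝ)-2*s)/4) := by positivity
  rw [Kc, cg, cg, mu0, e1, e2, e3, e4]
  field_simp

/-- Sharp Hardy inequality with remainder. -/
lemma hardy_sharp (N : ℕ) {s : ℝ} (hs0 : 0 < s) (hs1 : s < 1) (hN : 2 ≤ N)
    (v : EN N → ℝ) (hv : Measurable v) {ρ : ℝ} (hsupp : ∀ x, ρ < ‖x‖ → v x = 0)
    (hv2 : ∫⁻ x, ENNReal.ofReal (v x ^ 2) ≠ ⊤) :
    ENNReal.ofReal (CNs N s / 2) * (∫⁻ p : EN N × EN N,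
        ENNReal.ofReal (Rem (fun x => cg N ((N+2*s)/4) * ‖x‖ ^ (2*((N+2*s)/4)-N)) v p /
          dist p.1 p.2 ^ ((N:ℝ)+2*s))) +
    ENNReal.ofReal (- mu0 N s) * ∫⁻ x : EN N, ENNReal.ofReal (v x ^2 / ‖x‖ ^ (2*s)) ≤
    ENNReal.ofReal (CNs N s / 2) * ∫⁻ p : EN N × EN N,
        ENNReal.ofReal ((v p.1 - v p.2)^2 / dist p.1 p.2 ^ ((N:ℝ)+2*s)) := by
  have hNr : (2:ℝ) ≤ N := by exact_mod_cast hN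
  have : NeZero N := ⟨by omega⟩
  have hnt : Nontrivial (EN N) := by
    have : Nonempty (Fin N) := ⟨0⟩
    infer_instance
  have h2 := Real.Gamma_pos_of_pos (s := 1-s) (by linarith)
  have H := mul_le_mul_right (hardy_raw N hs0 hs1 hN v hv hsupp hv2)
    (ENNReal.ofReal (s / (2 * Real.Gamma (1-s))))
  have c1 := cg_pos (N := N) (γ := ((N:ℝ)+2*s)/4) (by linarith)
  have c2 := cg_pos (N := N) (γ := ((N:ℝ)+2*s)/4-s) (by linarith)
  have hsg : 0 ≤ s / (2 * Real.Gamma (1-s)) := by positivity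
  have hK : 0 ≤ Kc ((N+2*s)/4) s := by
    have h3 := Real.Gamma_pos_of_pos (s := ((N:ℝ)+2*s)/4) (by positivity)
    have h4 := Real.Gamma_pos_of_pos (s := ((N:ℝ)+2*s)/4-s) (by linarith)
    unfold Kc; positivity
  have hI : ∫⁻ x : EN N,
        ENNReal.ofReal (v x ^2 / (cg N ((N+2*s)/4) * ‖x‖ ^ (2*((N+2*s)/4)-N)) *
          (cg N ((N+2*s)/4-s) * ‖x‖ ^ (2*((N+2*s)/4-s)-N))) =
      ENNReal.ofReal (cg N ((N+2*s)/4-s) / cg N ((N+2*s)/4)) *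
        ∫⁻ x : EN N, ENNReal.ofReal (v x ^2 / ‖x‖ ^ (2*s)) := by
    rw [← lintegral_const_mul' _ _ ENNReal.ofReal_ne_top]
    have hae : ∀ᵐ x : EN N, x ≠ 0 := by simp [ae_iff]
    refine lintegral_congr_ae ?_
    filter_upwards [hae] with x hx
    have hx := norm_pos_iff.2 hx
    rw [← ENNReal.ofReal_mul (by positivity)]
    congr 1
    have e : ‖x‖ ^ (2*((N+2*s)/4)-N) = ‖x‖ ^ (2*s) * ‖x‖ ^ (2*((N+2*s)/4-s)-N) := by
      rw [← Real.rpow_add hx]; congr 1; ring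
    rw [e]
    have : 0 < ‖x‖ ^ (2*((N+2*s)/4-s)-N) := by positivity
    have : 0 < ‖x‖ ^ (2*s) := by positivity
    field_simp
  have k1 : ENNReal.ofReal (CNs N s / 2) =
      ENNReal.ofReal (s / (2 * Real.Gamma (1-s))) * ENNReal.ofReal (cg N (-s)) := by
    rw [← ENNReal.ofReal_mul hsg, CNs_eq N hs0 hs1]
  have k2 : ENNReal.ofReal (- mu0 N s) = ENNReal.ofReal (s / (2 * Real.Gamma (1-s))) *
      (2 * ENNReal.ofReal (Kc ((N+2*s)/4) s) *
        ENNReal.ofReal (cg N ((N+2*s)/4-s) / cg N ((N+2*s)/4))) := by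
    have : ENNReal.ofReal (2 * Kc ((N+2*s)/4) s) = 2 * ENNReal.ofReal (Kc ((N+2*s)/4) s) := by
      rw [ENNReal.ofReal_mul (by norm_num)]; simp
    rw [← this, ← ENNReal.ofReal_mul (by positivity), ← ENNReal.ofReal_mul hsg,
      mu0_eq hN hs0 hs1]
  rw [hI, mul_add] at H
  rw [k1, k2]
  simp only [mul_assoc] at H ⊢
  exact H

lemma ker_bound {N : ℕ} {q R δ : ℝ} (hq : 0 ≤ q) (hR : 0 ≤ R) (hδ : 0 < δ) {x y : EN N}
    (hx : ‖x‖ ≤ R) (hd : δ ≤ dist x y) :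
    1 / dist x y ^ q ≤ ((1/δ) ^ q + (R/δ+1) ^ q) * (1 / (1 + ‖y‖ ^ q)) := by
  have hd0 : 0 < dist x y := lt_of_lt_of_le hδ hd
  have h1 : (1:ℝ) ≤ (1/δ) ^ q * dist x y ^ q := by
    rw [← Real.mul_rpow (by positivity) hd0.le]
    refine Real.one_le_rpow ?_ hq
    rw [one_div, inv_mul_eq_div, le_div_iff₀ hδ]; linarith
  have h2 : ‖y‖ ^ q ≤ (R/δ+1) ^ q * dist x y ^ q := by
    rw [← Real.mul_rpow (by positivity) hd0.le]
    refine Real.rpow_le_rpow (norm_nonneg _) ?_ hq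
    have h3 : ‖y‖ ≤ ‖x‖ + dist x y := by
      have := norm_sub_norm_le y x
      rw [dist_comm, dist_eq_norm]; linarith
    have h4 : R ≤ R/δ * dist x y := by
      rw [div_mul_eq_mul_div, le_div_iff₀ hδ]
      exact mul_le_mul_of_nonneg_left hd hR
    linarith
  have h5 : 0 < dist x y ^ q := by positivity
  have h6 : 0 < 1 + ‖y‖ ^ q := by positivity
  rw [mul_one_div, div_le_div_iff₀ h5 h6]
  nlinarith

lemma int_w {N : ℕ} {q : ℝ} (hq : (N:ℝ) < q) :
    Integrable (fun y : EN N => 1 / (1 + ‖y‖ ^ q)) := by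
  have hq0 : 0 < q := lt_of_le_of_lt (by positivity) hq
  have h := integrable_one_add_norm (E := EN N) (μ := volume) (r := q) (by simpa using hq)
  refine (h.const_mul (2 ^ q)).mono' (by fun_prop : Measurable _).aestronglyMeasurable ?_
  refine Eventually.of_forall fun y => ?_
  have h6 : 0 < 1 + ‖y‖ ^ q := by positivity
  have h7 : 0 < (1 + ‖y‖) ^ q := by positivity
  rw [Real.norm_of_nonneg (by positivity), Real.rpow_neg (by positivity), ← div_eq_mul_inv,
    div_le_div_iff₀ h6 h7]
  have : (1 + ‖y‖) ^ q ≤ (2 * max 1 ‖y‖) ^ q := by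
    refine Real.rpow_le_rpow (by positivity) ?_ hq0.le
    have := le_max_left 1 ‖y‖
    have := le_max_right 1 ‖y‖
    linarith
  rw [Real.mul_rpow (by norm_num) (by positivity)] at this
  have h8 : (max 1 ‖y‖) ^ q ≤ 1 + ‖y‖ ^ q := by
    rcases max_cases 1 ‖y‖ with ⟨h, _⟩ | ⟨h, _⟩ <;> rw [h]
    · rw [Real.one_rpow]; linarith [show 0 ≤ ‖y‖^q by positivity]
    · linarith
  have h9 : (0:ℝ) < 2 ^ q := by positivity
  nlinarith

/-- The negative part. -/
def npart {N : ℕ} (u : EN N → ℝ) (x : EN N) : ℝ := max (-u x) 0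

lemma npart_lip (a b : ℝ) : |max (-a) 0 - max (-b) 0| ≤ |a - b| := by
  refine (abs_max_sub_max_le_abs _ _ _).trans ?_
  rw [neg_sub_neg, abs_sub_comm]

lemma npart_sign (a b : ℝ) :
    (max (-a) 0 - max (-b) 0)^2 ≤ -((a - b) * (max (-a) 0 - max (-b) 0)) := by
  rcases max_cases (-a) 0 with ⟨h, h'⟩ | ⟨h, h'⟩ <;>
    rcases max_cases (-b) 0 with ⟨k, k'⟩ | ⟨k, k'⟩ <;> rw [h, k] <;> nlinarith

lemma npart_le (a : ℝ) : |max (-a) 0| ≤ |a| := by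
  rw [abs_of_nonneg (le_max_right _ _)]
  exact max_le (neg_le_abs a) (abs_nonneg a)

lemma int_F {N : ℕ} {s : ℝ} (hs0 : 0 < s) {Ω : Set (EN N)} (hΩo : IsOpen Ω)
    (hΩb : Bornology.IsBounded Ω) {u : EN N → ℝ} (hum : Measurable u) (hu : MemWs N s Ω u)
    (hout : ∀ x ∉ Ω, 0 ≤ u x) :
    Integrable (fun p : EN N × EN N => (u p.1 - u p.2) * (npart u p.1 - npart u p.2) /
      dist p.1 p.2 ^ ((N:ℝ)+2*s)) := by
  obtain ⟨hL1, hL2, Ω', hΩ'o, -, hcl, hE⟩ := hu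
  have hv0 : ∀ x ∉ Ω, npart u x = 0 := fun x hx => by
    unfold npart; exact max_eq_right (by linarith [hout x hx])
  have hvm : Measurable (npart u) := by unfold npart; fun_prop
  set q : ℝ := (N:ℝ) + 2*s with hq
  have hqN : (N:ℝ) < q := by linarith
  have hq0 : 0 < q := lt_of_le_of_lt (by positivity) hqN
  set F : EN N × EN N → ℝ := fun p => (u p.1 - u p.2) * (npart u p.1 - npart u p.2) /
      dist p.1 p.2 ^ q with hF
  have hFm : Measurable F := by rw [hF]; fun_prop
  have hΩm := hΩo.measurableSet
  have hΩfin : volume Ω < ⊤ := hΩb.measure_lt_top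
  obtain ⟨R0, hR0⟩ := hΩb.exists_norm_le
  set R := max R0 0
  have hR : ∀ x ∈ Ω, ‖x‖ ≤ R := fun x hx => (hR0 x hx).trans (le_max_left _ _)
  obtain ⟨δ, hδ, hth⟩ := hΩb.isCompact_closure.exists_thickening_subset_open hΩ'o hcl
  have hdist : ∀ x ∈ Ω, ∀ y ∉ Ω', δ ≤ dist x y := by
    intro x hx y hy
    by_contra! h
    refine hy (hth ?_)
    rw [mem_thickening_iff]
    exact ⟨x, subset_closure hx, by rwa [dist_comm]⟩
  have hS1 : IntegrableOn F (Ω ×ˢ Ω') := by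
    refine Integrable.mono' hE hFm.aestronglyMeasurable (Eventually.of_forall fun p => ?_)
    have hd : 0 ≤ dist p.1 p.2 ^ q := by positivity
    rw [hF]
    simp only [Real.norm_eq_abs]
    rw [abs_div, abs_of_nonneg hd, abs_mul, ← sq_abs (u p.1 - u p.2), sq]
    refine div_le_div_of_nonneg_right ?_ hd
    exact mul_le_mul_of_nonneg_left (npart_lip _ _) (abs_nonneg _)
  have hS2 : IntegrableOn F (Ω ×ˢ Ω'ᶜ) := by
    set K : ℝ := (1/δ) ^ q + (R/δ+1) ^ q
    have i1 : Integrable (Ω.indicator (fun x => (u x)^2)) :=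
      (integrable_indicator_iff hΩm).2 hL2
    have i2 : Integrable (Ω.indicator (fun x => |u x|)) := by
      rw [integrable_indicator_iff hΩm]
      have h1 : IntegrableOn (fun _ : EN N => (1:ℝ)) Ω := integrableOn_const hΩfin.ne
      refine Integrable.mono' (h1.add hL2) (by fun_prop : Measurable _).aestronglyMeasurable
        (Eventually.of_forall fun x => ?_)
      simp only [Real.norm_eq_abs, abs_abs, Pi.add_apply]
      nlinarith [sq_abs (u x), sq_nonneg (|u x| - 1), abs_nonneg (u x)]
    have j1 := (int_w hqN).const_mul K
    have j2 : Integrable (fun y : EN N => K * |u y / (1 + ‖y‖ ^ q)|) := hL1.abs.const_mul K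
    have T := (i1.mul_prod j1).add (i2.mul_prod j2)
    rw [← Measure.volume_eq_prod] at T
    refine Integrable.mono' T.integrableOn hFm.aestronglyMeasurable ?_
    filter_upwards [ae_restrict_mem (hΩm.prod hΩ'o.measurableSet.compl)] with p hp
    obtain ⟨hp1, hp2⟩ := hp
    have hp2Ω : p.2 ∉ Ω := fun h => hp2 (hcl (subset_closure h))
    have hk := ker_bound hq0.le (le_max_right R0 0) hδ (hR _ hp1) (hdist _ hp1 _ hp2)
    have hd : 0 ≤ dist p.1 p.2 ^ q := by positivity
    have h6 : 0 < 1 + ‖p.2‖ ^ q := by positivity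
    rw [hF]
    simp only [Real.norm_eq_abs, Pi.add_apply, indicator_of_mem hp1]
    rw [hv0 _ hp2Ω, sub_zero, abs_div, abs_of_nonneg hd, abs_mul, abs_div, abs_of_pos h6]
    have a1 : |u p.1 - u p.2| ≤ |u p.1| + |u p.2| := abs_sub _ _
    have a2 : |npart u p.1| ≤ |u p.1| := npart_le _
    calc |u p.1 - u p.2| * |npart u p.1| / dist p.1 p.2 ^ q
        = |u p.1 - u p.2| * |npart u p.1| * (1 / dist p.1 p.2 ^ q) := by ring
      _ ≤ ((|u p.1| + |u p.2|) * |u p.1|) * (K * (1 / (1 + ‖p.2‖ ^ q))) := by gcongr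
      _ = _ := by rw [← sq_abs (u p.1)]; ring
  have hS : IntegrableOn F (Ω ×ˢ univ) := by
    have := hS1.union hS2
    rwa [← prod_union, union_compl_self] at this
  have hS' : IntegrableOn F (univ ×ˢ Ω) := by
    have h1 := (integrable_indicator_iff (hΩm.prod MeasurableSet.univ)).2 hS
    rw [← integrable_indicator_iff (MeasurableSet.univ.prod hΩm)]
    rw [Measure.volume_eq_prod] at h1 ⊢
    have h2 := h1.swap
    refine h2.congr (Eventually.of_forall fun p => ?_)
    simp only [Function.comp]
    by_cases hp : p.2 ∈ Ω
    · rw [indicator_of_mem (show p.swap ∈ Ω ×ˢ univ from ⟨hp, mem_univ _⟩),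
        indicator_of_mem (show p ∈ univ ×ˢ Ω from ⟨mem_univ _, hp⟩)]
      simp only [hF, Prod.fst_swap, Prod.snd_swap]
      rw [dist_comm]; congr 1; ring
    · rw [indicator_of_notMem (fun h : p.swap ∈ Ω ×ˢ univ => hp h.1),
        indicator_of_notMem (fun h : p ∈ univ ×ˢ Ω => hp h.2)]
  have hU := hS.union hS'
  rw [← integrable_indicator_iff ((hΩm.prod MeasurableSet.univ).union
    (MeasurableSet.univ.prod hΩm))] at hU
  refine hU.congr (Eventually.of_forall fun p => ?_)
  rw [indicator_apply_eq_self]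
  intro hp
  simp only [mem_union, mem_prod, mem_univ, and_true, true_and, not_or] at hp
  simp [hF, hv0 _ hp.1, hv0 _ hp.2]

lemma core (N : ℕ) (hN : 2 ≤ N) (s : ℝ) (hs : s ∈ Ioo (0:ℝ) 1)
    (μ : ℝ) (hμ : mu0 N s ≤ μ)
    (Ω : Set (EN N)) (hΩ : IsBoundedDomain N Ω)
    (u : EN N → ℝ) (hum : Measurable u) (hu : MemWs N s Ω u)
    (hout : ∀ x ∉ Ω, 0 ≤ u x)
    (hsuper : ∀ v : EN N → ℝ, MemHs0 N s Ω v → (∀ x, 0 ≤ v x) → 0 ≤ Esmu N s μ u v) :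
    ∀ᵐ x : EN N, 0 ≤ u x := by
  obtain ⟨hs0, hs1⟩ := hs
  obtain ⟨hΩo, -, hΩb⟩ := hΩ
  have : NeZero N := ⟨by omega⟩
  have hnt : Nontrivial (EN N) := by
    have : Nonempty (Fin N) := ⟨0⟩
    infer_instance
  have hFi := int_F hs0 hΩo hΩb hum hu hout
  have hv0 : ∀ x ∉ Ω, npart u x = 0 := fun x hx => by
    unfold npart; exact max_eq_right (by linarith [hout x hx])
  have hvm : Measurable (npart u) := by unfold npart; fun_prop
  have hvn : ∀ x, 0 ≤ npart u x := fun x => le_max_right _ _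
  set v := npart u with hv
  have hsq : ∀ x, v x ^ 2 ≤ u x ^ 2 := fun x => sq_le_sq.2 (npart_le _)
  have hv2 : Integrable (fun x => v x ^ 2) := by
    have i1 : Integrable (Ω.indicator (fun x => (u x)^2)) :=
      (integrable_indicator_iff hΩo.measurableSet).2 hu.2.1
    refine i1.mono' (by fun_prop : Measurable _).aestronglyMeasurable
      (Eventually.of_forall fun x => ?_)
    rw [Real.norm_of_nonneg (sq_nonneg _)]
    by_cases hx : x ∈ Ω
    · rw [indicator_of_mem hx]; exact hsq x
    · rw [indicator_of_notMem hx, hv0 x hx]; norm_num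
  have hGF : ∀ p : EN N × EN N, (v p.1 - v p.2)^2 / dist p.1 p.2 ^ ((N:ℝ)+2*s) ≤
      -((u p.1 - u p.2) * (v p.1 - v p.2) / dist p.1 p.2 ^ ((N:ℝ)+2*s)) := by
    intro p
    rw [← neg_div]
    exact div_le_div_of_nonneg_right (npart_sign _ _) (by positivity)
  have hG0 : ∀ p : EN N × EN N, 0 ≤ (v p.1 - v p.2)^2 / dist p.1 p.2 ^ ((N:ℝ)+2*s) :=
    fun p => by positivity
  have hGi : Integrable (fun p : EN N × EN N =>
      (v p.1 - v p.2)^2 / dist p.1 p.2 ^ ((N:ℝ)+2*s)) := by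
    refine hFi.neg.mono' (by fun_prop : Measurable _).aestronglyMeasurable
      (Eventually.of_forall fun p => ?_)
    rw [Real.norm_of_nonneg (hG0 p)]
    exact hGF p
  have hmem : MemHs0 N s Ω v := by
    refine ⟨⟨fun K _ => hv2.integrableOn, ?_⟩, Eventually.of_forall hv0⟩
    unfold FiniteEnergyOn
    exact hGi.integrableOn
  have hsup := hsuper v hmem hvn
  rw [Esmu, Es] at hsup
  have huv : (fun x : EN N => u x * v x / ‖x‖ ^ (2*s)) =
      fun x => - (v x ^ 2 / ‖x‖ ^ (2*s)) := by
    ext x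
    rw [← neg_div]
    congr 1
    simp only [hv, npart]
    rcases max_cases (-u x) 0 with ⟨h, h'⟩ | ⟨h, h'⟩ <;> rw [h] <;> ring
  rw [huv, integral_neg] at hsup
  have hC := CNs_pos N hs0 hs1
  have hm := mu0_neg hN hs0 hs1
  have hle : ∫ p : EN N × EN N, (v p.1 - v p.2)^2 / dist p.1 p.2 ^ ((N:ℝ)+2*s) ≤
      -∫ p : EN N × EN N, (u p.1 - u p.2) * (v p.1 - v p.2) / dist p.1 p.2 ^ ((N:ℝ)+2*s) := by
    rw [← integral_neg]
    exact integral_mono hGi hFi.neg hGF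
  obtain ⟨R, hR⟩ := hΩb.exists_norm_le
  have hsupp : ∀ x, R < ‖x‖ → v x = 0 := fun x hx => hv0 x fun h => absurd (hR x h) (not_le.2 hx)
  have hv2' : ∫⁻ x, ENNReal.ofReal (v x ^ 2) ≠ ⊤ := by
    rw [← ofReal_integral_eq_lintegral_ofReal hv2 (Eventually.of_forall fun x => sq_nonneg _)]
    exact ENNReal.ofReal_ne_top
  have H := hardy_sharp N hs0 hs1 hN v hvm hsupp hv2'
  rw [← ofReal_integral_eq_lintegral_ofReal hGi (Eventually.of_forall hG0)] at H
  have hB : ∫ x : EN N, v x ^ 2 / ‖x‖ ^ (2*s) =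
      (∫⁻ x : EN N, ENNReal.ofReal (v x ^2 / ‖x‖ ^ (2*s))).toReal :=
    integral_eq_lintegral_of_nonneg_ae (Eventually.of_forall fun x => by positivity)
      (by fun_prop : Measurable _).aestronglyMeasurable
  rw [hB] at hsup
  set h : EN N → ℝ := fun x => cg N ((N+2*s)/4) * ‖x‖ ^ (2*((N+2*s)/4)-N) with hh
  set A := ∫⁻ p : EN N × EN N, ENNReal.ofReal (Rem h v p / dist p.1 p.2 ^ ((N:ℝ)+2*s)) with hA
  set B := ∫⁻ x : EN N, ENNReal.ofReal (v x ^2 / ‖x‖ ^ (2*s))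
  set G := ∫ p : EN N × EN N, (v p.1 - v p.2)^2 / dist p.1 p.2 ^ ((N:ℝ)+2*s) with hG
  have hGnn : 0 ≤ G := integral_nonneg hG0
  rw [← ENNReal.ofReal_mul (by positivity)] at H
  have hfin := ne_top_of_le_ne_top ENNReal.ofReal_ne_top H
  rw [ENNReal.add_ne_top] at hfin
  have hAt : A ≠ ⊤ := by
    intro h
    rw [h, ENNReal.mul_top (by simp; positivity)] at hfin
    exact hfin.1 rfl
  have H' := ENNReal.toReal_mono ENNReal.ofReal_ne_top H
  rw [ENNReal.toReal_add hfin.1 hfin.2, ENNReal.toReal_mul, ENNReal.toReal_mul,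
    ENNReal.toReal_ofReal (by positivity), ENNReal.toReal_ofReal (by linarith),
    ENNReal.toReal_ofReal (by positivity)] at H'
  have hBn : 0 ≤ B.toReal := ENNReal.toReal_nonneg
  have hAz : A.toReal = 0 := by
    refine le_antisymm ?_ ENNReal.toReal_nonneg
    have z1 : 0 ≤ (μ - mu0 N s) * B.toReal := mul_nonneg (by linarith) hBn
    have z2 := mul_le_mul_of_nonneg_left hle (show 0 ≤ CNs N s / 2 by positivity)
    have : CNs N s / 2 * A.toReal ≤ 0 := by linarith
    by_contra! hc
    have := mul_pos (show 0 < CNs N s / 2 by positivity) hc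
    linarith
  have hA0 : A = 0 := (ENNReal.toReal_eq_zero_iff _).1 hAz |>.resolve_right hAt
  have hhm : Measurable h := by rw [hh]; fun_prop
  rw [hA, lintegral_eq_zero_iff (by unfold Rem; fun_prop), Measure.volume_eq_prod] at hA0
  have hP := Measure.ae_ae_of_ae_prod hA0
  have hae : ∀ᵐ x : EN N, x ≠ 0 := by simp [ae_iff]
  have hpos : ∀ x : EN N, x ≠ 0 → 0 < h x := by
    intro x hx
    have hNr : (2:ℝ) ≤ N := by exact_mod_cast hN
    have := cg_pos (N := N) (γ := ((N:ℝ)+2*s)/4) (by linarith)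
    have := norm_pos_iff.2 hx
    rw [hh]; positivity
  filter_upwards [hP, hae] with x hx hx0
  by_contra! hux
  have hvx : 0 < v x := lt_of_lt_of_le (by linarith) (le_max_left (-u x) 0)
  have hxΩ : x ∈ Ω := by
    by_contra hc
    exact absurd (hout x hc) (not_le.2 hux)
  have hin : ∀ᵐ y : EN N, y ∈ Ω := by
    filter_upwards [hx, hae] with y hy hy0
    by_contra hyΩ
    have hxy : x ≠ y := fun h => hyΩ (h ▸ hxΩ)
    have hd := dist_pos.2 hxy
    have p1 := hpos x hx0
    have p2 := hpos y hy0
    simp only [Pi.zero_apply, ENNReal.ofReal_eq_zero, Rem, hv0 y hyΩ, zero_div, sub_zero] at hy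
    have : 0 < h x * h y * (v x / h x)^2 / dist x y ^ ((N:ℝ)+2*s) := by positivity
    linarith
  have hcompl : volume Ωᶜ = 0 := hin
  have hun : volume (univ : Set (EN N)) ≤ volume Ω + volume Ωᶜ := by
    rw [← union_compl_self Ω]; exact measure_union_le _ _
  rw [hcompl, add_zero, measure_univ_of_isAddLeftInvariant] at hun
  exact absurd hΩb.measure_lt_top (not_lt.2 hun)
/-- Lemma 4.6 (comparison principle, version 1): if `u ∈ W^s(Ω)`
satisfies `L^s_μ u ≥ 0` in `Ω` in the weak sense and `u ≥ 0` outside `Ω`, then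
`u ≥ 0` a.e. in `ℝ^N`. -/
theorem comparison_principle_v1
    (N : ℕ) (hN : 2 ≤ N) (s : ℝ) (hs : s ∈ Ioo (0:ℝ) 1)
    (μ : ℝ) (hμ : mu0 N s ≤ μ)
    (Ω : Set (EN N)) (hΩ : IsBoundedDomain N Ω)
    (u : EN N → ℝ) (hu : MemWs N s Ω u)
    (hout : ∀ᵐ x : EN N, x ∉ Ω → 0 ≤ u x)
    (hsuper : ∀ v : EN N → ℝ, MemHs0 N s Ω v → (∀ x, 0 ≤ v x) → 0 ≤ Esmu N s μ u v) :
    ∀ᵐ x : EN N, 0 ≤ u x := by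
  obtain ⟨hL1, hL2, Ω', hΩ'o, hΩ'c, hcl, hE⟩ := hu
  have hum : AEMeasurable u := by
    have h1 : AEMeasurable (fun x : EN N => u x / (1 + ‖x‖ ^ ((N:ℝ) + 2*s))) :=
      Integrable.aemeasurable hL1
    have h2 : AEMeasurable (fun x : EN N => (1 + ‖x‖ ^ ((N:ℝ) + 2*s))) :=
      (by fun_prop : Measurable _).aemeasurable
    refine (h1.mul h2).congr (Eventually.of_forall fun x => ?_)
    have : 0 < 1 + ‖x‖ ^ ((N:ℝ) + 2*s) := by positivity
    simp only [Pi.mul_apply]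
    field_simp
  classical
  have hΩm : MeasurableSet Ω := hΩ.1.measurableSet
  set w : EN N → ℝ := Ω.piecewise (hum.mk u) (fun x => |hum.mk u x|) with hw
  have hwm : Measurable w := hum.measurable_mk.piecewise hΩm
    (by have := hum.measurable_mk; fun_prop)
  have huw : ∀ᵐ x : EN N, u x = w x := by
    filter_upwards [hum.ae_eq_mk, hout] with x hx hx'
    by_cases h : x ∈ Ω
    · rw [hw, piecewise_eq_of_mem _ _ _ h, hx]
    · rw [hw, piecewise_eq_of_notMem _ _ _ h, ← hx, abs_of_nonneg (hx' h)]
  have huw2 : ∀ᵐ p : EN N × EN N, u p.1 = w p.1 ∧ u p.2 = w p.2 := by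
    rw [Measure.volume_eq_prod]
    exact (Measure.quasiMeasurePreserving_fst.ae huw).and
      (Measure.quasiMeasurePreserving_snd.ae huw)
  have key := core N hN s hs μ hμ Ω hΩ w hwm ⟨?_, ?_, Ω', hΩ'o, hΩ'c, hcl, ?_⟩ ?_ ?_
  · filter_upwards [key, huw] with x hx hx'
    rwa [hx']
  · refine Integrable.congr hL1 ?_
    filter_upwards [huw] with x hx
    rw [hx]
  · refine Integrable.congr hL2 (ae_restrict_of_ae ?_)
    filter_upwards [huw] with x hx
    rw [hx]
  · refine Integrable.congr hE (ae_restrict_of_ae ?_)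
    filter_upwards [huw2] with p hp
    rw [hp.1, hp.2]
  · intro x hx
    rw [hw, piecewise_eq_of_notMem _ _ _ hx]
    exact abs_nonneg _
  · intro v hv hv0
    have h := hsuper v hv hv0
    have e1 : Esmu N s μ u v = Esmu N s μ w v := by
      unfold Esmu Es
      congr 2
      · refine integral_congr_ae ?_
        filter_upwards [huw2] with p hp
        rw [hp.1, hp.2]
      · refine integral_congr_ae ?_
        filter_upwards [huw] with x hx
        rw [hx]
    rwa [← e1]
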